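/- arXiv:1911.00360 — 6 statements merged into one kernel-verified Lean document; each statement's English description precedes it below -/
import Mathlib

section
/- Let α be a real 3×3 matrix with entries αᵢⱼ, let Qᵢ(x,y,z) = αᵢ₁ z² + αᵢ₂ xz + αᵢ₃ yz for i = 1,2,3, and let f(x,y,z) = (x, y, Q₁(x,y,z), Q₂(x,y,z), Q₃(x,y,z)). Then f is A²-equivalent to g₂(x,y,z) = (x,y,z²,xz,0) if and only if the curvature locus Δ_f is a planar region that is not a whole plane; precisely, if and only if there exists a 2-dimensional linear subspace W of ℝ³ such that Δ_f ⊆ W, the linear span of Δ_f equals W, and Δ_f ≠ W. -/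
noncomputable section

/-- Two smooth map germs `(ℝ³,0) → (ℝ⁵,0)` are `𝒜²`-equivalent: there are smooth
changes of coordinates in source and target, fixing the origin and with invertible
differential at the origin, such that the composites have the same 2-jet at `0`. -/
def A2Equiv (f g : (Fin 3 → ℝ) → (Fin 5 → ℝ)) : Prop :=
  ∃ (ψ : (Fin 3 → ℝ) → (Fin 3 → ℝ)) (φ : (Fin 5 → ℝ) → (Fin 5 → ℝ))
    (ψ' : (Fin 3 → ℝ) ≃L[ℝ] (Fin 3 → ℝ)) (φ' : (Fin 5 → ℝ) ≃L[ℝ] (Fin 5 → ℝ)),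
    ContDiff ℝ (⊤ : ℕ∞) ψ ∧ ContDiff ℝ (⊤ : ℕ∞) φ ∧ ψ 0 = 0 ∧ φ 0 = 0 ∧
    HasFDerivAt ψ (ψ' : (Fin 3 → ℝ) →L[ℝ] (Fin 3 → ℝ)) 0 ∧
    HasFDerivAt φ (φ' : (Fin 5 → ℝ) →L[ℝ] (Fin 5 → ℝ)) 0 ∧
    ∀ k : ℕ, k ≤ 2 → iteratedFDeriv ℝ k (φ ∘ f ∘ ψ) 0 = iteratedFDeriv ℝ k g 0

def g1 : (Fin 3 → ℝ) → (Fin 5 → ℝ) := fun p => ![p 0, p 1, p 0 * p 2, p 1 * p 2, p 2 ^ 2]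
def g2 : (Fin 3 → ℝ) → (Fin 5 → ℝ) := fun p => ![p 0, p 1, p 2 ^ 2, p 0 * p 2, 0]
def g3 : (Fin 3 → ℝ) → (Fin 5 → ℝ) := fun p => ![p 0, p 1, p 0 * p 2, p 1 * p 2, 0]
def g4 : (Fin 3 → ℝ) → (Fin 5 → ℝ) := fun p => ![p 0, p 1, p 2 ^ 2, 0, 0]
def g5 : (Fin 3 → ℝ) → (Fin 5 → ℝ) := fun p => ![p 0, p 1, p 0 * p 2, 0, 0]
def g6 : (Fin 3 → ℝ) → (Fin 5 → ℝ) := fun p => ![p 0, p 1, 0, 0, 0]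

/-- The curvature locus at the origin of a corank 1 3-manifold in Monge form with
quadratic part `Q = (Q₁,Q₂,Q₃)`: the image of the unit cylinder `a² + b² = 1`
under twice the quadratic part, inside the normal space `ℝ³`. -/
def curvLocus (Q : Fin 3 → (Fin 3 → ℝ) → ℝ) : Set (Fin 3 → ℝ) :=
  {v | ∃ a b c : ℝ, a ^ 2 + b ^ 2 = 1 ∧
    v = ![2 * Q 0 ![a, b, c], 2 * Q 1 ![a, b, c], 2 * Q 2 ![a, b, c]]}

/-- The first two coordinates, seen inside the tangent plane of `ℝ⁵`. -/
def tangentPart : (Fin 3 → ℝ) →ₗ[ℝ] (Fin 5 → ℝ) where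
  toFun p := ![p 0, p 1, 0, 0, 0]
  map_add' p q := by ext i; fin_cases i <;> simp
  map_smul' c p := by ext i; fin_cases i <;> simp

/-- The inclusion of the normal space `ℝ³` into `ℝ⁵` as the last three coordinates. -/
def normalIncl : (Fin 3 → ℝ) →ₗ[ℝ] (Fin 5 → ℝ) where
  toFun w := ![0, 0, w 0, w 1, w 2]
  map_add' p q := by ext i; fin_cases i <;> simp
  map_smul' c p := by ext i; fin_cases i <;> simp

/-- The linear map `(a, b, c) ↦ cA + aB + bC`, where `A`, `B`, `C` are the columns of `α`. -/
def halfForm (α : Matrix (Fin 3) (Fin 3) ℝ) : (Fin 3 → ℝ) →ₗ[ℝ] (Fin 3 → ℝ) where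
  toFun v i := α i 0 * v 2 + α i 1 * v 0 + α i 2 * v 1
  map_add' p q := by ext i; simp; ring
  map_smul' c p := by ext i; simp; ring

/-- The second fundamental form paired with the kernel direction `e_z`:
`(a, b, c) ↦ 2cA + aB + bC`, where `A`, `B`, `C` are the columns of `α`. -/
def kernelForm (α : Matrix (Fin 3) (Fin 3) ℝ) : (Fin 3 → ℝ) →ₗ[ℝ] (Fin 3 → ℝ) where
  toFun v i := 2 * α i 0 * v 2 + α i 1 * v 0 + α i 2 * v 1
  map_add' p q := by ext i; simp; ring
  map_smul' c p := by ext i; simp; ring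

lemma kernelForm_apply (α : Matrix (Fin 3) (Fin 3) ℝ) (v : Fin 3 → ℝ) (i : Fin 3) :
    kernelForm α v i = 2 * α i 0 * v 2 + α i 1 * v 0 + α i 2 * v 1 := rfl

/-- A bilinear form whose diagonal is the quadratic part of the special Monge form. -/
def mongeBilin (α : Matrix (Fin 3) (Fin 3) ℝ) :
    (Fin 3 → ℝ) →ₗ[ℝ] (Fin 3 → ℝ) →ₗ[ℝ] (Fin 5 → ℝ) :=
  LinearMap.mk₂ ℝ (fun u v => u 2 • normalIncl (halfForm α v))
    (fun _ _ _ => by simp [add_smul]) (fun _ _ _ => by simp [mul_smul])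
    (fun _ _ _ => by simp) (fun _ _ _ => by simp [smul_smul, mul_comm])

/-- The special Monge form with coefficient matrix `α`. -/
def mongeMap (α : Matrix (Fin 3) (Fin 3) ℝ) (p : Fin 3 → ℝ) : Fin 5 → ℝ :=
  tangentPart.toContinuousLinearMap p + (mongeBilin α).toContinuousBilinearMap p p

lemma mongeMap_apply (α : Matrix (Fin 3) (Fin 3) ℝ) (p : Fin 3 → ℝ) :
    mongeMap α p = ![p 0, p 1, p 2 * halfForm α p 0, p 2 * halfForm α p 1,
      p 2 * halfForm α p 2] := by
  ext i; fin_cases i <;> simp [mongeMap, tangentPart, mongeBilin, normalIncl]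

/-- The coefficient matrix of `g2`. -/
def g2Coeff : Matrix (Fin 3) (Fin 3) ℝ := !![1, 0, 0; 0, 1, 0; 0, 0, 0]

lemma g2_eq_mongeMap : g2 = mongeMap g2Coeff := by
  funext p
  rw [mongeMap_apply]
  ext i; fin_cases i <;> simp [g2, halfForm, g2Coeff] <;> ring

lemma contDiff_mongeMap (α : Matrix (Fin 3) (Fin 3) ℝ) :
    ContDiff ℝ (⊤ : ℕ∞) (mongeMap α) := by
  unfold mongeMap
  fun_prop

lemma hasFDerivAt_mongeMap (α : Matrix (Fin 3) (Fin 3) ℝ) (x : Fin 3 → ℝ) :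
    HasFDerivAt (mongeMap α) (tangentPart.toContinuousLinearMap +
      ((mongeBilin α).toContinuousBilinearMap +
        (mongeBilin α).toContinuousBilinearMap.flip) x) x := by
  have h := (tangentPart.toContinuousLinearMap.hasFDerivAt (x := x)).add
    ((mongeBilin α).toContinuousBilinearMap.hasFDerivAt_of_bilinear
      (hasFDerivAt_id x) (hasFDerivAt_id x))
  refine h.congr_fderiv ?_
  ext v
  simp

lemma fderiv_mongeMap_zero (α : Matrix (Fin 3) (Fin 3) ℝ) (v : Fin 3 → ℝ) :
    fderiv ℝ (mongeMap α) 0 v = tangentPart v := by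
  rw [(hasFDerivAt_mongeMap α 0).fderiv]; simp

lemma fderiv_fderiv_mongeMap (α : Matrix (Fin 3) (Fin 3) ℝ) (u v : Fin 3 → ℝ) :
    fderiv ℝ (fderiv ℝ (mongeMap α)) 0 u v = mongeBilin α u v + mongeBilin α v u := by
  have h : fderiv ℝ (mongeMap α) = fun x => tangentPart.toContinuousLinearMap +
      ((mongeBilin α).toContinuousBilinearMap +
        (mongeBilin α).toContinuousBilinearMap.flip) x :=
    funext fun x => (hasFDerivAt_mongeMap α x).fderiv
  rw [h, fderiv_const_add, ContinuousLinearMap.fderiv]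
  simp

lemma fderiv_fderiv_mongeMap_of_tangentPart_eq_zero (α : Matrix (Fin 3) (Fin 3) ℝ)
    {u : Fin 3 → ℝ} (hu : tangentPart u = 0) (v : Fin 3 → ℝ) :
    fderiv ℝ (fderiv ℝ (mongeMap α)) 0 u v = u 2 • normalIncl (kernelForm α v) := by
  have h0 : u 0 = 0 := by simpa [tangentPart] using congrFun hu 0
  have h1 : u 1 = 0 := by simpa [tangentPart] using congrFun hu 1
  rw [fderiv_fderiv_mongeMap]
  ext i
  fin_cases i <;> simp [mongeBilin, normalIncl, halfForm, kernelForm, h0, h1] <;> ring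

/-- The chain rule for second derivatives. -/
lemma fderiv_fderiv_comp {E F G : Type*} [NormedAddCommGroup E] [NormedSpace ℝ E]
    [NormedAddCommGroup F] [NormedSpace ℝ F] [NormedAddCommGroup G] [NormedSpace ℝ G]
    {φ : F → G} {h : E → F} (hφ : ContDiff ℝ (⊤ : ℕ∞) φ) (hh : ContDiff ℝ (⊤ : ℕ∞) h)
    (x u v : E) :
    fderiv ℝ (fderiv ℝ (φ ∘ h)) x u v =
      fderiv ℝ (fderiv ℝ φ) (h x) (fderiv ℝ h x u) (fderiv ℝ h x v) +
        fderiv ℝ φ (h x) (fderiv ℝ (fderiv ℝ h) x u v) := by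
  have dφ : Differentiable ℝ φ := hφ.differentiable (by simp)
  have dh : Differentiable ℝ h := hh.differentiable (by simp)
  have dφ' : Differentiable ℝ (fderiv ℝ φ) :=
    (hφ.fderiv_right (m := (⊤ : ℕ∞)) le_rfl).differentiable (by simp)
  have dh' : Differentiable ℝ (fderiv ℝ h) :=
    (hh.fderiv_right (m := (⊤ : ℕ∞)) le_rfl).differentiable (by simp)
  have e : fderiv ℝ (φ ∘ h) = fun y => (fderiv ℝ φ (h y)).comp (fderiv ℝ h y) :=
    funext fun y => fderiv_comp y (dφ _) (dh _)
  have hc : HasFDerivAt (fun y => fderiv ℝ φ (h y))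
      ((fderiv ℝ (fderiv ℝ φ) (h x)).comp (fderiv ℝ h x)) x :=
    (dφ' (h x)).hasFDerivAt.comp x (dh x).hasFDerivAt
  rw [e, (hc.clm_comp (dh' x).hasFDerivAt).fderiv]
  simp [add_comm]

lemma normalIncl_eq_tangentPart {w v : Fin 3 → ℝ} (h : normalIncl w = tangentPart v) :
    w = 0 := by
  ext i
  fin_cases i
  · simpa [normalIncl, tangentPart] using congrFun h 2
  · simpa [normalIncl, tangentPart] using congrFun h 3
  · simpa [normalIncl, tangentPart] using congrFun h 4

lemma kernelForm_of_tangentPart_eq_zero (α : Matrix (Fin 3) (Fin 3) ℝ)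
    {u : Fin 3 → ℝ} (hu : tangentPart u = 0) :
    kernelForm α u = u 2 • kernelForm α ![0, 0, 1] := by
  have h0 : u 0 = 0 := by simpa [tangentPart] using congrFun hu 0
  have h1 : u 1 = 0 := by simpa [tangentPart] using congrFun hu 1
  ext i
  simp [kernelForm, h0, h1]; ring

/-- `𝒜²`-equivalence of special Monge forms preserves the kernel of `kernelForm` up to a
linear isomorphism, and the non-vanishing of `kernelForm` on the kernel direction. -/
lemma kernelForm_of_A2Equiv {α β : Matrix (Fin 3) (Fin 3) ℝ}
    (h : A2Equiv (mongeMap α) (mongeMap β)) :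
    (∃ e : (Fin 3 → ℝ) ≃ₗ[ℝ] (Fin 3 → ℝ),
      LinearMap.ker (kernelForm α) = (LinearMap.ker (kernelForm β)).map e.toLinearMap) ∧
    (kernelForm β ![0, 0, 1] ≠ 0 → kernelForm α ![0, 0, 1] ≠ 0) := by
  obtain ⟨ψ, φ, ψ', φ', cψ, cφ, ψ0, φ0, dψ, dφ, hk⟩ := h
  have hf0 : mongeMap α 0 = 0 := by simp [mongeMap]
  have cH : ContDiff ℝ (⊤ : ℕ∞) (mongeMap α ∘ ψ) := (contDiff_mongeMap α).comp cψ
  have H0 : (mongeMap α ∘ ψ) 0 = 0 := by simp [ψ0, hf0]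
  have dH : ∀ v, fderiv ℝ (mongeMap α ∘ ψ) 0 v = tangentPart (ψ' v) := by
    intro v
    rw [fderiv_comp _ ((contDiff_mongeMap α).differentiable (by simp) _)
      (cψ.differentiable (by simp) _), ψ0, dψ.fderiv]
    simpa using fderiv_mongeMap_zero α (ψ' v)
  have first : ∀ v, φ' (tangentPart (ψ' v)) = tangentPart v := by
    intro v
    have := DFunLike.congr_fun (hk 1 (by norm_num)) (fun _ => v)
    rw [iteratedFDeriv_one_apply, iteratedFDeriv_one_apply, fderiv_mongeMap_zero,
      fderiv_comp _ (cφ.differentiable (by simp) _) (cH.differentiable (by simp) _), H0,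
      dφ.fderiv] at this
    simpa [dH] using this
  have hz : tangentPart ![0, 0, 1] = 0 := by
    ext i; fin_cases i <;> simp [tangentPart]
  set u := ψ' ![0, 0, 1] with hu
  have hPu : tangentPart u = 0 := φ'.injective (by rw [first, hz, map_zero])
  have hu2 : u 2 ≠ 0 := by
    intro h2
    have : u = 0 := by
      ext i
      fin_cases i
      · simpa [tangentPart] using congrFun hPu 0
      · simpa [tangentPart] using congrFun hPu 1
      · simpa using h2
    have := congrFun (ψ'.map_eq_zero_iff.1 this) 2
    simp at this
  have second : ∀ v, ∃ w, φ' (u 2 • normalIncl (kernelForm α (ψ' v))) + tangentPart w =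
      normalIncl (kernelForm β v) := by
    intro v
    have := DFunLike.congr_fun (hk 2 le_rfl) ![![0, 0, 1], v]
    rw [iteratedFDeriv_two_apply, iteratedFDeriv_two_apply, fderiv_fderiv_comp cφ cH,
      fderiv_fderiv_comp (contDiff_mongeMap α) cψ, H0, dφ.fderiv, ψ0, dψ.fderiv] at this
    simp only [Matrix.cons_val_zero, Matrix.cons_val_one, dH, fderiv_mongeMap_zero,
      ContinuousLinearEquiv.coe_coe, ← hu, hPu, map_zero, zero_apply,
      zero_add, map_add, fderiv_fderiv_mongeMap_of_tangentPart_eq_zero α hPu,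
      fderiv_fderiv_mongeMap_of_tangentPart_eq_zero β hz] at this
    refine ⟨ψ'.symm (fderiv ℝ (fderiv ℝ ψ) 0 ![0, 0, 1] v), ?_⟩
    rw [← first, ContinuousLinearEquiv.apply_symm_apply, map_smul]
    simpa using this
  have key : ∀ v, kernelForm α (ψ' v) = 0 ↔ kernelForm β v = 0 := by
    intro v
    obtain ⟨w, hw⟩ := second v
    constructor
    · intro h0
      rw [h0] at hw
      simp only [map_zero, smul_zero, zero_add] at hw
      exact normalIncl_eq_tangentPart hw.symm
    · intro h0
      rw [h0, map_zero, ← first, ← map_add] at hw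
      have h1 := (φ'.map_eq_zero_iff).1 hw
      rw [← map_smul, add_eq_zero_iff_eq_neg, ← map_neg] at h1
      exact (smul_eq_zero.1 (normalIncl_eq_tangentPart h1)).resolve_left hu2
  refine ⟨⟨ψ'.toLinearEquiv, ?_⟩, fun hβ hα => ?_⟩
  · ext v
    simp only [LinearMap.mem_ker, Submodule.mem_map]
    constructor
    · intro hv
      exact ⟨ψ'.symm v, (key _).1 (by simpa using hv), by simp⟩
    · rintro ⟨w, hw, rfl⟩
      exact (key w).2 hw
  · refine hβ ((key _).1 ?_)
    rw [← hu, kernelForm_of_tangentPart_eq_zero α hPu, hα, smul_zero]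

lemma finrank_ker_kernelForm_g2Coeff :
    Module.finrank ℝ (LinearMap.ker (kernelForm g2Coeff)) = 1 := by
  have : LinearMap.ker (kernelForm g2Coeff) = Submodule.span ℝ {![0, 1, 0]} := by
    ext v
    rw [LinearMap.mem_ker, Submodule.mem_span_singleton]
    constructor
    · intro h
      have h0 := congrFun h 0
      have h1 := congrFun h 1
      simp [kernelForm, g2Coeff] at h0 h1
      exact ⟨v 1, by ext i; fin_cases i <;> simp [h0, h1]⟩
    · rintro ⟨c, rfl⟩
      ext i; fin_cases i <;> simp [kernelForm, g2Coeff]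
  rw [this, finrank_span_singleton]
  intro h
  simpa using congrFun h 1

lemma kernelForm_g2Coeff_ne_zero : kernelForm g2Coeff ![0, 0, 1] ≠ 0 := by
  intro h
  simpa [kernelForm, g2Coeff] using congrFun h 0

/-- Two linearly independent vectors of `ℝ³` can be mapped to the first two basis vectors. -/
lemma exists_linearEquiv_of_linearIndependent {a b : Fin 3 → ℝ}
    (h : LinearIndependent ℝ ![a, b]) :
    ∃ T : (Fin 3 → ℝ) ≃ₗ[ℝ] (Fin 3 → ℝ), T a = ![1, 0, 0] ∧ T b = ![0, 1, 0] := by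
  obtain ⟨c, hc⟩ := exists_linearIndependent_snoc_of_lt_finrank h (by simp)
  let B := basisOfLinearIndependentOfCardEqFinrank hc (by simp)
  have hB : ∀ i, B i = (Fin.snoc ![a, b] c : Fin 3 → Fin 3 → ℝ) i := fun i => by
    simp [B]
  have h0 : B 0 = a := hB 0
  have h1 : B 1 = b := hB 1
  refine ⟨B.equivFun, ?_, ?_⟩
  · rw [← h0]; ext i; fin_cases i <;> simp
  · rw [← h1]; ext i; fin_cases i <;> simp

/-- A linear change of coordinates in the source sending `e_y` to `k` and fixing `e_z`. -/
def sourceChange (k : Fin 3 → ℝ) : (Fin 3 → ℝ) →ₗ[ℝ] (Fin 3 → ℝ) where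
  toFun p := ![-(k 1) * p 0 + k 0 * p 1, k 0 * p 0 + k 1 * p 1, k 2 * p 1 + p 2]
  map_add' p q := by ext i; fin_cases i <;> simp <;> ring
  map_smul' c p := by ext i; fin_cases i <;> simp <;> ring

/-- The linear change of coordinates in the target which undoes `sourceChange k` on the tangent
plane and acts by `T` on the normal space. -/
def targetChange (k : Fin 3 → ℝ) (T : (Fin 3 → ℝ) ≃ₗ[ℝ] (Fin 3 → ℝ)) :
    (Fin 5 → ℝ) →ₗ[ℝ] (Fin 5 → ℝ) where
  toFun q := ![(-(k 1) * q 0 + k 0 * q 1) / (k 0 ^ 2 + k 1 ^ 2),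
    (k 0 * q 0 + k 1 * q 1) / (k 0 ^ 2 + k 1 ^ 2),
    T ![q 2, q 3, q 4] 0, T ![q 2, q 3, q 4] 1, T ![q 2, q 3, q 4] 2]
  map_add' p q := by
    have : ![(p + q) 2, (p + q) 3, (p + q) 4] = ![p 2, p 3, p 4] + ![q 2, q 3, q 4] := by
      simp
    rw [this, map_add]
    ext i; fin_cases i <;> simp <;> ring
  map_smul' c p := by
    have : ![(c • p) 2, (c • p) 3, (c • p) 4] = c • ![p 2, p 3, p 4] := by simp
    rw [this, map_smul]
    ext i; fin_cases i <;> simp <;> ring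

lemma eq_zero_of_rotation_eq_zero {a b x y : ℝ} (hn : a ^ 2 + b ^ 2 ≠ 0)
    (h0 : -b * x + a * y = 0) (h1 : a * x + b * y = 0) : x = 0 ∧ y = 0 := by
  have hx : x * (a ^ 2 + b ^ 2) = 0 := by linear_combination -b * h0 + a * h1
  have hy : y * (a ^ 2 + b ^ 2) = 0 := by linear_combination a * h0 + b * h1
  exact ⟨(mul_eq_zero.1 hx).resolve_right hn, (mul_eq_zero.1 hy).resolve_right hn⟩

lemma sourceChange_injective {k : Fin 3 → ℝ} (hn : k 0 ^ 2 + k 1 ^ 2 ≠ 0) :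
    Function.Injective (sourceChange k) := by
  rw [← LinearMap.ker_eq_bot, LinearMap.ker_eq_bot']
  intro p hp
  obtain ⟨p0, p1⟩ := eq_zero_of_rotation_eq_zero hn (congrFun hp 0) (congrFun hp 1)
  have p2 : p 2 = 0 := by simpa [sourceChange, p1] using congrFun hp 2
  ext i; fin_cases i <;> simp [p0, p1, p2]

lemma targetChange_injective {k : Fin 3 → ℝ} (hn : k 0 ^ 2 + k 1 ^ 2 ≠ 0)
    (T : (Fin 3 → ℝ) ≃ₗ[ℝ] (Fin 3 → ℝ)) : Function.Injective (targetChange k T) := by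
  rw [← LinearMap.ker_eq_bot, LinearMap.ker_eq_bot']
  intro q hq
  obtain ⟨q0, q1⟩ := eq_zero_of_rotation_eq_zero hn
    ((div_eq_zero_iff.1 (congrFun hq 0)).resolve_right hn)
    ((div_eq_zero_iff.1 (congrFun hq 1)).resolve_right hn)
  have hT : T ![q 2, q 3, q 4] = 0 := by
    ext i
    fin_cases i
    exacts [congrFun hq 2, congrFun hq 3, congrFun hq 4]
  have h2 := (LinearEquiv.map_eq_zero_iff T).1 hT
  have q2 : q 2 = 0 := congrFun h2 0
  have q3 : q 3 = 0 := congrFun h2 1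
  have q4 : q 4 = 0 := congrFun h2 2
  ext i; fin_cases i <;> simp [q0, q1, q2, q3, q4]

lemma targetChange_mongeMap_sourceChange {α : Matrix (Fin 3) (Fin 3) ℝ} {k : Fin 3 → ℝ}
    (hk : kernelForm α k = 0) (hn : k 0 ^ 2 + k 1 ^ 2 ≠ 0)
    {T : (Fin 3 → ℝ) ≃ₗ[ℝ] (Fin 3 → ℝ)} (hTa : T (fun i => α i 0) = ![1, 0, 0])
    (hTb : T (fun i => -(k 1) * α i 1 + k 0 * α i 2) = ![0, 1, 0]) (p : Fin 3 → ℝ) :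
    targetChange k T (mongeMap α (sourceChange k p)) =
      ![p 0, p 1, p 2 ^ 2 - k 2 ^ 2 * p 1 ^ 2, p 0 * p 2 + k 2 * (p 0 * p 1), 0] := by
  have hv : ![mongeMap α (sourceChange k p) 2, mongeMap α (sourceChange k p) 3,
      mongeMap α (sourceChange k p) 4] =
      (p 2 ^ 2 - k 2 ^ 2 * p 1 ^ 2) • (fun i => α i 0) +
        (p 0 * p 2 + k 2 * (p 0 * p 1)) • (fun i => -(k 1) * α i 1 + k 0 * α i 2) := by
    ext i
    have := congrFun hk i
    rw [kernelForm_apply] at this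
    fin_cases i <;> simp [mongeMap_apply, halfForm, sourceChange] at this ⊢ <;>
      linear_combination (p 1 * (k 2 * p 1 + p 2)) * this
  have m0 : mongeMap α (sourceChange k p) 0 = -(k 1) * p 0 + k 0 * p 1 := by
    simp [mongeMap_apply, sourceChange]
  have m1 : mongeMap α (sourceChange k p) 1 = k 0 * p 0 + k 1 * p 1 := by
    simp [mongeMap_apply, sourceChange]
  simp only [targetChange, LinearMap.coe_mk, AddHom.coe_mk]
  rw [hv, map_add, map_smul, map_smul, hTa, hTb, m0, m1]
  ext i
  fin_cases i <;> simp
  · rw [div_eq_iff hn]; ring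
  · rw [div_eq_iff hn]; ring

lemma A2Equiv_g2_of_kernelForm {α : Matrix (Fin 3) (Fin 3) ℝ}
    (hker : Module.finrank ℝ (LinearMap.ker (kernelForm α)) = 1)
    (hz : kernelForm α ![0, 0, 1] ≠ 0) : A2Equiv (mongeMap α) g2 := by
  obtain ⟨⟨k, hk⟩, hk0, hspan⟩ := finrank_eq_one_iff'.1 hker
  have hk0' : k ≠ 0 := fun h => hk0 (Subtype.ext h)
  have hspan' : ∀ w, kernelForm α w = 0 → ∃ c : ℝ, c • k = w := fun w hw => by
    obtain ⟨c, hc⟩ := hspan ⟨w, hw⟩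
    exact ⟨c, congrArg Subtype.val hc⟩
  have hkα : ∀ i, 2 * α i 0 * k 2 + α i 1 * k 0 + α i 2 * k 1 = 0 := fun i => congrFun hk i
  have hn : 0 < k 0 ^ 2 + k 1 ^ 2 := by
    by_contra! hle
    have e0 : k 0 = 0 := by nlinarith [sq_nonneg (k 0), sq_nonneg (k 1)]
    have e1 : k 1 = 0 := by nlinarith [sq_nonneg (k 0), sq_nonneg (k 1)]
    have e2 : k 2 ≠ 0 := fun e2 => hk0' (by ext i; fin_cases i <;> simp [e0, e1, e2])
    apply hz
    ext i
    have := hkα i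
    simp only [e0, e1, mul_zero, add_zero, mul_eq_zero, e2, or_false] at this
    simp [kernelForm_apply]
    simpa using this
  have hn' := hn.ne'
  let a : Fin 3 → ℝ := fun i => α i 0
  let b : Fin 3 → ℝ := fun i => -(k 1) * α i 1 + k 0 * α i 2
  have hab : LinearIndependent ℝ ![a, b] := by
    rw [LinearIndependent.pair_iff]
    intro s t hst
    obtain ⟨c, hc⟩ := hspan' ![-(k 1) * t, k 0 * t, s / 2] (by
      ext i
      have := congrFun hst i
      simp [a, b] at this
      simp [kernelForm_apply]
      linarith)
    have c0 : c * k 0 = -(k 1) * t := congrFun hc 0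
    have c1 : c * k 1 = k 0 * t := congrFun hc 1
    have c2 : c * k 2 = s / 2 := congrFun hc 2
    obtain ⟨ht, hc0⟩ := eq_zero_of_rotation_eq_zero (x := t) (y := -c) hn'
      (by linarith) (by linarith)
    rw [neg_eq_zero.1 hc0, zero_mul] at c2
    exact ⟨by linarith, ht⟩
  obtain ⟨T, hTa, hTb⟩ := exists_linearEquiv_of_linearIndependent hab
  let ψ' := (LinearEquiv.ofInjectiveEndo _ (sourceChange_injective hn')).toContinuousLinearEquiv
  let φ' := (LinearEquiv.ofInjectiveEndo _
    (targetChange_injective hn' T)).toContinuousLinearEquiv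
  have hψ' : ∀ p, ψ' p = sourceChange k p := fun _ => rfl
  have hφ' : ∀ q, φ' q = targetChange k T q := fun _ => rfl
  clear_value ψ' φ'
  let φ : (Fin 5 → ℝ) → (Fin 5 → ℝ) := fun q =>
    φ' q + ((φ' q 1) ^ 2 • ![0, 0, k 2 ^ 2, 0, 0] +
      (φ' q 0 * φ' q 1) • ![0, 0, 0, -k 2, 0])
  refine ⟨ψ', φ, ψ', φ', ψ'.contDiff, by fun_prop, by simp, by simp [φ], ψ'.hasFDerivAt,
    ?_, ?_⟩
  · have hi : ∀ i, HasFDerivAt (fun q => φ' q i)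
        ((ContinuousLinearMap.proj i).comp (φ' : (Fin 5 → ℝ) →L[ℝ] (Fin 5 → ℝ))) 0 := fun i =>
      ((ContinuousLinearMap.proj (R := ℝ) i).comp
        (φ' : (Fin 5 → ℝ) →L[ℝ] (Fin 5 → ℝ))).hasFDerivAt
    refine (φ'.hasFDerivAt.add ((((hi 1).pow 2).smul_const _).add
      (((hi 0).mul (hi 1)).smul_const _))).congr_fderiv ?_
    ext v i
    simp
  · intro m _
    have : φ ∘ mongeMap α ∘ ψ' = g2 := by
      funext p
      simp only [Function.comp_apply, φ, hψ', hφ',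
        targetChange_mongeMap_sourceChange hk hn' hTa hTb]
      ext i
      fin_cases i <;> simp [g2]
      all_goals ring
    rw [this]

lemma finrank_range_kernelForm_eq_two_iff (α : Matrix (Fin 3) (Fin 3) ℝ) :
    Module.finrank ℝ (LinearMap.range (kernelForm α)) = 2 ↔
      Module.finrank ℝ (LinearMap.ker (kernelForm α)) = 1 := by
  have := LinearMap.finrank_range_add_finrank_ker (kernelForm α)
  simp only [Module.finrank_fin_fun] at this
  omega

lemma A2Equiv_g2_iff_kernelForm (α : Matrix (Fin 3) (Fin 3) ℝ) :
    A2Equiv (mongeMap α) g2 ↔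
      Module.finrank ℝ (LinearMap.range (kernelForm α)) = 2 ∧
        kernelForm α ![0, 0, 1] ≠ 0 := by
  rw [finrank_range_kernelForm_eq_two_iff]
  constructor
  · intro h
    rw [g2_eq_mongeMap] at h
    obtain ⟨⟨e, he⟩, hne⟩ := kernelForm_of_A2Equiv h
    refine ⟨?_, hne kernelForm_g2Coeff_ne_zero⟩
    rw [he, ← finrank_ker_kernelForm_g2Coeff]
    exact LinearEquiv.finrank_map_eq e _
  · rintro ⟨h1, h2⟩
    exact A2Equiv_g2_of_kernelForm h1 h2

/-- The points of the curvature locus of a special Monge form. -/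
lemma mem_curvLocus_iff {α : Matrix (Fin 3) (Fin 3) ℝ} {Q : Fin 3 → (Fin 3 → ℝ) → ℝ}
    (hQ : ∀ i p, Q i p = α i 0 * p 2 ^ 2 + α i 1 * p 0 * p 2 + α i 2 * p 1 * p 2)
    (v : Fin 3 → ℝ) :
    v ∈ curvLocus Q ↔ ∃ a b c : ℝ, a ^ 2 + b ^ 2 = 1 ∧
      v = kernelForm α ![2 * a * c, 2 * b * c, c ^ 2] := by
  refine exists₃_congr fun a b c => and_congr_right fun _ => ?_
  have : ![2 * Q 0 ![a, b, c], 2 * Q 1 ![a, b, c], 2 * Q 2 ![a, b, c]] =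
      kernelForm α ![2 * a * c, 2 * b * c, c ^ 2] := by
    ext i; fin_cases i <;> simp [kernelForm_apply, hQ] <;> ring
  rw [this]

lemma span_curvLocus {α : Matrix (Fin 3) (Fin 3) ℝ} {Q : Fin 3 → (Fin 3 → ℝ) → ℝ}
    (hQ : ∀ i p, Q i p = α i 0 * p 2 ^ 2 + α i 1 * p 0 * p 2 + α i 2 * p 1 * p 2) :
    Submodule.span ℝ (curvLocus Q) = LinearMap.range (kernelForm α) := by
  apply le_antisymm
  · rw [Submodule.span_le]
    intro v hv
    obtain ⟨a, b, c, -, rfl⟩ := (mem_curvLocus_iff hQ v).1 hv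
    exact ⟨_, rfl⟩
  · rintro _ ⟨v, rfl⟩
    have mem : ∀ a b c : ℝ, a ^ 2 + b ^ 2 = 1 →
        kernelForm α ![2 * a * c, 2 * b * c, c ^ 2] ∈ Submodule.span ℝ (curvLocus Q) :=
      fun a b c h => Submodule.subset_span ((mem_curvLocus_iff hQ _).2 ⟨a, b, c, h, rfl⟩)
    have e : kernelForm α v =
        (v 2 / 2 + v 0 / 4) • kernelForm α ![2 * 1 * 1, 2 * 0 * 1, 1 ^ 2] +
        (v 2 / 2 - v 0 / 4) • kernelForm α ![2 * 1 * (-1), 2 * 0 * (-1), (-1) ^ 2] +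
        ((v 1 / 4) • kernelForm α ![2 * 0 * 1, 2 * 1 * 1, 1 ^ 2] -
        (v 1 / 4) • kernelForm α ![2 * 0 * (-1), 2 * 1 * (-1), (-1) ^ 2]) := by
      ext i; simp [kernelForm_apply]; ring
    rw [e]
    refine add_mem (add_mem ?_ ?_) (sub_mem ?_ ?_) <;>
      exact Submodule.smul_mem _ _ (mem _ _ _ (by norm_num))

lemma curvLocus_eq_range_iff {α : Matrix (Fin 3) (Fin 3) ℝ} {Q : Fin 3 → (Fin 3 → ℝ) → ℝ}
    (hQ : ∀ i p, Q i p = α i 0 * p 2 ^ 2 + α i 1 * p 0 * p 2 + α i 2 * p 1 * p 2) :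
    curvLocus Q = LinearMap.range (kernelForm α) ↔ kernelForm α ![0, 0, 1] = 0 := by
  constructor
  · intro h
    by_contra hz
    set A := kernelForm α ![0, 0, 1] with hA
    set B := kernelForm α ![1, 0, 0] with hB
    set C := kernelForm α ![0, 1, 0] with hC
    have hAA : 0 < A ⬝ᵥ A := by
      refine lt_of_le_of_ne ?_ (Ne.symm (by simpa using hz))
      simp only [dotProduct, ← sq]
      positivity
    set m := 2 * (|A ⬝ᵥ B| + |A ⬝ᵥ C|) / (A ⬝ᵥ A) with hm
    have hmem : -(m ^ 2 + 1) • A ∈ curvLocus Q := by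
      rw [h]
      exact ⟨-(m ^ 2 + 1) • ![0, 0, 1], by rw [map_smul]⟩
    obtain ⟨a, b, c, hab, e⟩ := (mem_curvLocus_iff hQ _).1 hmem
    have e' : -(m ^ 2 + 1) • A = c ^ 2 • A + ((2 * a * c) • B + (2 * b * c) • C) := by
      rw [e]
      ext i; simp [hA, hB, hC, kernelForm_apply]; ring
    have e2 := congrArg (fun v => A ⬝ᵥ v) e'
    simp only [dotProduct_add, dotProduct_smul, smul_eq_mul] at e2
    have ha : |a| ≤ 1 := abs_le_one_iff_mul_self_le_one.2 (by nlinarith [sq_nonneg b])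
    have hb : |b| ≤ 1 := abs_le_one_iff_mul_self_le_one.2 (by nlinarith [sq_nonneg a])
    have bd : ∀ s x : ℝ, |s| ≤ 1 → -(2 * s * c * x) ≤ 2 * |c| * |x| := by
      intro s x hs
      calc -(2 * s * c * x) ≤ |2 * s * c * x| := neg_le_abs _
        _ = |s| * (2 * |c| * |x|) := by simp only [abs_mul, abs_two]; ring
        _ ≤ 2 * |c| * |x| := mul_le_of_le_one_left (by positivity) hs
    have b1 := bd a (A ⬝ᵥ B) ha
    have b2 := bd b (A ⬝ᵥ C) hb
    have hm' : m * (A ⬝ᵥ A) = 2 * (|A ⬝ᵥ B| + |A ⬝ᵥ C|) := div_mul_cancel₀ _ hAA.ne'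
    have h3 : (c ^ 2 + m ^ 2 + 1 - |c| * m) * (A ⬝ᵥ A) ≤ 0 := by
      have : |c| * m * (A ⬝ᵥ A) = 2 * |c| * |A ⬝ᵥ B| + 2 * |c| * |A ⬝ᵥ C| := by
        rw [mul_assoc, hm']; ring
      linarith
    have h4 : 0 < c ^ 2 + m ^ 2 + 1 - |c| * m := by
      nlinarith [sq_nonneg (|c| - m), sq_abs c, sq_nonneg c, sq_nonneg m]
    exact absurd h3 (not_le.2 (mul_pos h4 hAA))
  · intro hz
    refine Set.Subset.antisymm (by rw [← span_curvLocus hQ]; exact Submodule.subset_span) ?_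
    rintro _ ⟨v, rfl⟩
    rw [mem_curvLocus_iff hQ]
    have hα : ∀ i, α i 0 = 0 := fun i => by
      simpa [kernelForm_apply] using congrFun hz i
    by_cases hv : v 0 ^ 2 + v 1 ^ 2 = 0
    · have e0 : v 0 = 0 := by nlinarith [sq_nonneg (v 0), sq_nonneg (v 1)]
      have e1 : v 1 = 0 := by nlinarith [sq_nonneg (v 0), sq_nonneg (v 1)]
      exact ⟨1, 0, 0, by norm_num, by ext i; simp [kernelForm_apply, hα, e0, e1]⟩
    · have hr : √(v 0 ^ 2 + v 1 ^ 2) ^ 2 = v 0 ^ 2 + v 1 ^ 2 := Real.sq_sqrt (by positivity)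
      set r := √(v 0 ^ 2 + v 1 ^ 2)
      have hr0 : r ≠ 0 := fun h => hv (by rw [← hr, h]; norm_num)
      refine ⟨v 0 / r, v 1 / r, r / 2, ?_, ?_⟩
      · rw [div_pow, div_pow, ← add_div, ← hr, div_self (pow_ne_zero 2 hr0)]
      · ext i
        simp [kernelForm_apply, hα]
        field_simp

/-- For the special Monge form, `𝒜²`-equivalence to `(x,y,z²,xz,0)` is characterised
by the curvature locus being a planar region which is not a whole plane. -/
theorem A2_equiv_g2_iff_locus_planar_region
    (α : Matrix (Fin 3) (Fin 3) ℝ) (Q : Fin 3 → (Fin 3 → ℝ) → ℝ)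
    (hQ : ∀ i p, Q i p = α i 0 * p 2 ^ 2 + α i 1 * p 0 * p 2 + α i 2 * p 1 * p 2)
    (f : (Fin 3 → ℝ) → (Fin 5 → ℝ))
    (hf : ∀ p, f p = ![p 0, p 1, Q 0 p, Q 1 p, Q 2 p]) :
    A2Equiv f g2 ↔
      ∃ W : Submodule ℝ (Fin 3 → ℝ), Module.finrank ℝ W = 2 ∧
        curvLocus Q ⊆ (W : Set (Fin 3 → ℝ)) ∧
        Submodule.span ℝ (curvLocus Q) = W ∧
        curvLocus Q ≠ (W : Set (Fin 3 → ℝ)) := by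
  have hfα : f = mongeMap α := by
    funext p
    rw [hf, mongeMap_apply]
    ext i; fin_cases i <;> simp [hQ, halfForm] <;> ring
  rw [hfα, A2Equiv_g2_iff_kernelForm, ne_eq, ← curvLocus_eq_range_iff hQ]
  constructor
  · rintro ⟨h2, hne⟩
    exact ⟨_, h2, by rw [← span_curvLocus hQ]; exact Submodule.subset_span,
      span_curvLocus hQ, hne⟩
  · rintro ⟨W, h2, -, hW, hne⟩
    obtain rfl : W = LinearMap.range (kernelForm α) := by rw [← hW, span_curvLocus hQ]
    exact ⟨h2, hne⟩
end
end

section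
/- Let α be a real 3×3 matrix with entries αᵢⱼ, let Qᵢ(x,y,z) = αᵢ₁ z² + αᵢ₂ xz + αᵢ₃ yz for i = 1,2,3, and let f(x,y,z) = (x, y, Q₁(x,y,z), Q₂(x,y,z), Q₃(x,y,z)). Then f is A²-equivalent to g₃(x,y,z) = (x,y,xz,yz,0) if and only if the curvature locus Δ_f is a plane; precisely, if and only if Δ_f is equal to a 2-dimensional linear subspace of ℝ³. -/
noncomputable section

/-- The projection of `ℝ³` onto its first two coordinates, seen as a map into `ℝ⁵`. -/
def mongeLinear : (Fin 3 → ℝ) →L[ℝ] (Fin 5 → ℝ) :=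
  LinearMap.toContinuousLinearMap
    { toFun := fun p => ![p 0, p 1, 0, 0, 0]
      map_add' := fun p q => by ext i; fin_cases i <;> simp
      map_smul' := fun r p => by ext i; fin_cases i <;> simp }

/-- The linear factor `L` of the quadratic part `p ↦ z • L p` of a special Monge form. -/
def mongeFactor (α : Matrix (Fin 3) (Fin 3) ℝ) : (Fin 3 → ℝ) →L[ℝ] (Fin 5 → ℝ) :=
  LinearMap.toContinuousLinearMap
    { toFun := fun p => ![0, 0, α 0 0 * p 2 + α 0 1 * p 0 + α 0 2 * p 1,
        α 1 0 * p 2 + α 1 1 * p 0 + α 1 2 * p 1, α 2 0 * p 2 + α 2 1 * p 0 + α 2 2 * p 1]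
      map_add' := fun p q => by ext i; fin_cases i <;> simp <;> ring
      map_smul' := fun r p => by ext i; fin_cases i <;> simp <;> ring }

/-- The special Monge form with coefficient matrix `α`. -/
def mongeForm (α : Matrix (Fin 3) (Fin 3) ℝ) (p : Fin 3 → ℝ) : Fin 5 → ℝ :=
  mongeLinear p + p 2 • mongeFactor α p

lemma mongeLinear_apply (p : Fin 3 → ℝ) : mongeLinear p = ![p 0, p 1, 0, 0, 0] := rfl

lemma mongeFactor_apply (α : Matrix (Fin 3) (Fin 3) ℝ) (p : Fin 3 → ℝ) :
    mongeFactor α p = ![0, 0, α 0 0 * p 2 + α 0 1 * p 0 + α 0 2 * p 1,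
      α 1 0 * p 2 + α 1 1 * p 0 + α 1 2 * p 1, α 2 0 * p 2 + α 2 1 * p 0 + α 2 2 * p 1] := rfl

lemma g3_eq_mongeForm : g3 = mongeForm !![0, 1, 0; 0, 0, 1; 0, 0, 0] := by
  ext p i
  fin_cases i <;> simp [g3, mongeForm, mongeLinear_apply, mongeFactor_apply, mul_comm]

lemma contDiff_mongeForm (α : Matrix (Fin 3) (Fin 3) ℝ) {n : WithTop ℕ∞} :
    ContDiff ℝ n (mongeForm α) := by
  unfold mongeForm
  fun_prop

lemma mongeForm_zero (α : Matrix (Fin 3) (Fin 3) ℝ) : mongeForm α 0 = 0 := by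
  simp [mongeForm]

lemma hasFDerivAt_mongeForm (α : Matrix (Fin 3) (Fin 3) ℝ) (p : Fin 3 → ℝ) :
    HasFDerivAt (mongeForm α) (mongeLinear + (p 2 • mongeFactor α +
      (ContinuousLinearMap.proj (R := ℝ) (φ := fun _ : Fin 3 => ℝ) 2).smulRight
        (mongeFactor α p))) p :=
  mongeLinear.hasFDerivAt.add
    ((ContinuousLinearMap.proj (R := ℝ) (φ := fun _ : Fin 3 => ℝ) 2).hasFDerivAt.smul
      (mongeFactor α).hasFDerivAt)

lemma fderiv_mongeForm_zero (α : Matrix (Fin 3) (Fin 3) ℝ) :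
    fderiv ℝ (mongeForm α) 0 = mongeLinear := by
  rw [(hasFDerivAt_mongeForm α 0).fderiv]
  ext v i
  simp

lemma fderiv_apply_hasFDerivAt {E F : Type*} [NormedAddCommGroup E] [NormedSpace ℝ E]
    [NormedAddCommGroup F] [NormedSpace ℝ F] {h : E → F} (hh : ContDiff ℝ 2 h) (x v : E) :
    HasFDerivAt (fun y => fderiv ℝ h y v)
      ((fderiv ℝ (fderiv ℝ h) x).flip v) x := by
  have h1 : DifferentiableAt ℝ (fderiv ℝ h) x :=
    ((hh.fderiv_right (m := 1) (by norm_num)).differentiable (by norm_num)) x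
  have := h1.hasFDerivAt.clm_apply (hasFDerivAt_const v x)
  convert this using 1
  ext w
  simp

lemma fderiv_fderiv_mongeForm (α : Matrix (Fin 3) (Fin 3) ℝ) (p v : Fin 3 → ℝ) :
    fderiv ℝ (fderiv ℝ (mongeForm α)) p v v = (2 * v 2) • mongeFactor α v := by
  have h1 := fderiv_apply_hasFDerivAt (contDiff_mongeForm α (n := 2)) p v
  have h2 : (fun y => fderiv ℝ (mongeForm α) y v) =
      fun y => mongeLinear v + (y 2 • mongeFactor α v + v 2 • mongeFactor α y) := by
    ext1 y
    rw [(hasFDerivAt_mongeForm α y).fderiv]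
    simp
  rw [h2] at h1
  have h3 : HasFDerivAt (fun y : Fin 3 → ℝ =>
      mongeLinear v + (y 2 • mongeFactor α v + v 2 • mongeFactor α y))
      ((ContinuousLinearMap.proj (R := ℝ) (φ := fun _ : Fin 3 => ℝ) 2).smulRight
        (mongeFactor α v) + v 2 • mongeFactor α) p :=
    ((((ContinuousLinearMap.proj (R := ℝ) (φ := fun _ : Fin 3 => ℝ) 2).smulRight
        (mongeFactor α v)).hasFDerivAt).add
          ((v 2 • mongeFactor α).hasFDerivAt)).const_add _
  have h4 := congrArg (fun T => T v) (h1.unique h3)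
  simp only [ContinuousLinearMap.flip_apply] at h4
  rw [h4]
  simp [two_mul, add_smul]

/-- The second-order chain rule on the diagonal. -/
lemma fderiv_fderiv_comp_apply {E F G : Type*} [NormedAddCommGroup E] [NormedSpace ℝ E]
    [NormedAddCommGroup F] [NormedSpace ℝ F] [NormedAddCommGroup G] [NormedSpace ℝ G]
    {h : F → G} {k : E → F} (hh : ContDiff ℝ 2 h) (hk : ContDiff ℝ 2 k) (x v : E) :
    fderiv ℝ (fderiv ℝ (h ∘ k)) x v v =
      fderiv ℝ (fderiv ℝ h) (k x) (fderiv ℝ k x v) (fderiv ℝ k x v) +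
        fderiv ℝ h (k x) (fderiv ℝ (fderiv ℝ k) x v v) := by
  have hd : Differentiable ℝ h := hh.differentiable (by norm_num)
  have kd : Differentiable ℝ k := hk.differentiable (by norm_num)
  have hd' : Differentiable ℝ (fderiv ℝ h) :=
    (hh.fderiv_right (m := 1) (by norm_num)).differentiable (by norm_num)
  have h1 := fderiv_apply_hasFDerivAt (hh.comp hk) x v
  have h2 : (fun y => fderiv ℝ (h ∘ k) y v) = fun y => fderiv ℝ h (k y) (fderiv ℝ k y v) := by
    ext1 y
    rw [fderiv_comp y (hd _) (kd _)]
    rfl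
  rw [h2] at h1
  have h3 := ((hd' (k x)).hasFDerivAt.comp x (kd x).hasFDerivAt).clm_apply
    (fderiv_apply_hasFDerivAt hk x v)
  have h4 := congrArg (fun T => T v) (h1.unique h3)
  simp only [ContinuousLinearMap.flip_apply] at h4
  rw [h4]
  simp [add_comm]

/-- Relations between the 2-jets of the coordinate changes in an `𝒜²`-equivalence of Monge forms. -/
lemma jet_relations {α β : Matrix (Fin 3) (Fin 3) ℝ}
    (h : A2Equiv (mongeForm α) (mongeForm β)) :
    ∃ (ψ' : (Fin 3 → ℝ) ≃L[ℝ] (Fin 3 → ℝ)) (φ' : (Fin 5 → ℝ) ≃L[ℝ] (Fin 5 → ℝ))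
      (B : (Fin 5 → ℝ) → (Fin 5 → ℝ)) (S : (Fin 3 → ℝ) → (Fin 3 → ℝ)), B 0 = 0 ∧
      (∀ v, φ' (mongeLinear (ψ' v)) = mongeLinear v) ∧
      ∀ v, B (mongeLinear (ψ' v)) +
        φ' ((2 * ψ' v 2) • mongeFactor α (ψ' v) + mongeLinear (S v)) =
          (2 * v 2) • mongeFactor β v := by
  obtain ⟨ψ, φ, ψ', φ', hψ, hφ, ψ0, φ0, dψ, dφ, hk⟩ := h
  have hψ2 : ContDiff ℝ 2 ψ := contDiff_infty.1 hψ 2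
  have hφ2 : ContDiff ℝ 2 φ := contDiff_infty.1 hφ 2
  have hf2 := contDiff_mongeForm α (n := 2)
  have hd : Differentiable ℝ (mongeForm α) := hf2.differentiable (by norm_num)
  have hinner : fderiv ℝ (mongeForm α ∘ ψ) 0 = mongeLinear ∘L (ψ' : _ →L[ℝ] _) := by
    rw [fderiv_comp _ (hd _) dψ.differentiableAt, ψ0, fderiv_mongeForm_zero, dψ.fderiv]
  have hz : (mongeForm α ∘ ψ) 0 = 0 := by simp [ψ0, mongeForm_zero]
  have hfirst : fderiv ℝ (φ ∘ mongeForm α ∘ ψ) 0 = fderiv ℝ (mongeForm β) 0 := by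
    ext1 v
    have := congrArg (fun T => T ![v]) (hk 1 (by norm_num))
    simpa [iteratedFDeriv_one_apply] using this
  refine ⟨ψ', φ', fun y => fderiv ℝ (fderiv ℝ φ) 0 y y,
    fun v => fderiv ℝ (fderiv ℝ ψ) 0 v v, by simp, fun v => ?_, fun v => ?_⟩
  · have h1 : fderiv ℝ (φ ∘ mongeForm α ∘ ψ) 0 v = φ' (mongeLinear (ψ' v)) := by
      rw [fderiv_comp _ (hφ2.differentiable (by norm_num) _)
        ((hf2.comp hψ2).differentiable (by norm_num) _), hinner, hz, dφ.fderiv]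
      rfl
    rw [← h1, hfirst, fderiv_mongeForm_zero]
  · have h2 := congrArg (fun T => T ![v, v]) (hk 2 le_rfl)
    simp only [iteratedFDeriv_two_apply, Matrix.cons_val_zero, Matrix.cons_val_one] at h2
    rw [fderiv_fderiv_mongeForm, fderiv_fderiv_comp_apply hφ2 (hf2.comp hψ2),
      fderiv_fderiv_comp_apply hf2 hψ2, hinner, hz, dφ.fderiv, ψ0, fderiv_mongeForm_zero,
      dψ.fderiv] at h2
    simpa [fderiv_fderiv_mongeForm] using h2

lemma mongeLinear_eq_zero_iff {p : Fin 3 → ℝ} : mongeLinear p = 0 ↔ p 0 = 0 ∧ p 1 = 0 := by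
  rw [mongeLinear_apply]
  constructor
  · intro h
    exact ⟨by simpa using congrFun h 0, by simpa using congrFun h 1⟩
  · rintro ⟨h0, h1⟩
    ext i
    fin_cases i <;> simp [h0, h1]

/-- The algebraic condition on the coefficients equivalent to both sides of the theorem. -/
def IsPlanar (α : Matrix (Fin 3) (Fin 3) ℝ) : Prop :=
  α.col 0 = 0 ∧ LinearIndependent ℝ ![α.col 1, α.col 2]

lemma IsPlanar.of_a2Equiv {α : Matrix (Fin 3) (Fin 3) ℝ} (h : A2Equiv (mongeForm α) g3) :
    IsPlanar α := by
  rw [g3_eq_mongeForm] at h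
  obtain ⟨ψ', φ', B, S, hB, h1, h2⟩ := jet_relations h
  set e : Fin 3 → ℝ := ![0, 0, 1] with he
  have hJe : mongeLinear (ψ' e) = 0 := by
    apply φ'.injective
    rw [h1, map_zero, mongeLinear_eq_zero_iff]
    simp [he]
  obtain ⟨he0, he1⟩ := mongeLinear_eq_zero_iff.1 hJe
  have hl : ψ' e 2 ≠ 0 := by
    intro h0
    have h3 : ψ' e = 0 := by
      ext i
      fin_cases i
      exacts [he0, he1, h0]
    have h4 : e = 0 := ψ'.injective (by rw [h3, map_zero])
    simpa [he] using congrFun h4 2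
  have hA : α.col 0 = 0 := by
    have h3 := h2 e
    rw [hJe, hB, zero_add] at h3
    have h4 : (2 * ψ' e 2) • mongeFactor α (ψ' e) + mongeLinear (S e) = 0 := by
      apply φ'.injective
      rw [h3, map_zero, mongeFactor_apply]
      ext i
      fin_cases i <;> simp [he]
    rw [mongeFactor_apply, mongeLinear_apply] at h4
    ext i
    fin_cases i
    · simpa [he0, he1, hl] using congrFun h4 2
    · simpa [he0, he1, hl] using congrFun h4 3
    · simpa [he0, he1, hl] using congrFun h4 4
  refine ⟨hA, LinearIndependent.pair_iff.2 fun r s hrs => ?_⟩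
  have hA' (i) : α i 0 = 0 := congrFun hA i
  have hrs' (i) : α i 1 * r + α i 2 * s = 0 := by
    have := congrFun hrs i
    simp at this
    linarith
  obtain ⟨w, hw⟩ := ψ'.surjective ![r, s, 0]
  have hw0 : ψ' w 0 = r := by simp [hw]
  have hw1 : ψ' w 1 = s := by simp [hw]
  have hJ : mongeLinear (ψ' (w + e)) = mongeLinear (ψ' w) := by simp [hJe]
  have hf0 : mongeFactor α (ψ' w) = 0 := by
    rw [mongeFactor_apply]
    ext i
    fin_cases i <;> simp [hA', hw0, hw1, hrs']
  have hf1 : mongeFactor α (ψ' (w + e)) = 0 := by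
    rw [mongeFactor_apply]
    ext i
    fin_cases i <;> simp [hA', hw0, hw1, he0, he1, hrs']
  have h3 := h2 w
  have h4 := h2 (w + e)
  rw [hf0, smul_zero, zero_add] at h3
  rw [hf1, hJ, smul_zero, zero_add] at h4
  obtain ⟨u, hu⟩ := ψ'.surjective (S (w + e))
  obtain ⟨u', hu'⟩ := ψ'.surjective (S w)
  rw [← hu', h1] at h3
  rw [← hu, h1] at h4
  have h5 : mongeLinear u - mongeLinear u' = (2 * (w + e) 2) •
      mongeFactor !![0, 1, 0; 0, 0, 1; 0, 0, 0] (w + e) -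
        (2 * w 2) • mongeFactor !![0, 1, 0; 0, 0, 1; 0, 0, 0] w := by
    rw [← h3, ← h4]
    abel
  simp only [mongeFactor_apply, mongeLinear_apply] at h5
  have h6 := congrFun h5 2
  have h7 := congrFun h5 3
  simp [he] at h6 h7
  have h8 : mongeLinear (ψ' w) = 0 := by
    apply φ'.injective
    rw [h1, map_zero, mongeLinear_eq_zero_iff]
    constructor <;> linarith
  rw [mongeLinear_eq_zero_iff, hw0, hw1] at h8
  exact h8

lemma IsPlanar.a2Equiv {α : Matrix (Fin 3) (Fin 3) ℝ} (h : IsPlanar α) :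
    A2Equiv (mongeForm α) g3 := by
  obtain ⟨hA, hli⟩ := h
  obtain ⟨C, hC⟩ : ∃ C : Fin 3 → ℝ, C ∉ Submodule.span ℝ (Set.range ![α.col 1, α.col 2]) := by
    by_contra! hC
    have h1 := (Submodule.eq_top_iff'.2 hC) ▸ finrank_span_eq_card hli
    simp at h1
  have hli3 := hli.finCons (x := C) hC
  let Ψ : (Fin 5 → ℝ) →ₗ[ℝ] (Fin 5 → ℝ) :=
    { toFun := fun y => ![y 0, y 1, α 0 1 * y 2 + α 0 2 * y 3 + C 0 * y 4,
        α 1 1 * y 2 + α 1 2 * y 3 + C 1 * y 4, α 2 1 * y 2 + α 2 2 * y 3 + C 2 * y 4]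
      map_add' := fun p q => by ext i; fin_cases i <;> simp <;> ring
      map_smul' := fun r p => by ext i; fin_cases i <;> simp <;> ring }
  have hΨ (y) : Ψ y = ![y 0, y 1, α 0 1 * y 2 + α 0 2 * y 3 + C 0 * y 4,
        α 1 1 * y 2 + α 1 2 * y 3 + C 1 * y 4, α 2 1 * y 2 + α 2 2 * y 3 + C 2 * y 4] := rfl
  have hinj : Function.Injective Ψ := by
    rw [injective_iff_map_eq_zero]
    intro y hy
    rw [hΨ] at hy
    have h0 := congrFun hy 0
    have h1 := congrFun hy 1
    have h2 := congrFun hy 2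
    have h3 := congrFun hy 3
    have h4 := congrFun hy 4
    simp at h0 h1 h2 h3 h4
    have h5 := Fintype.linearIndependent_iff.1 hli3 ![y 4, y 2, y 3] (by
      ext i
      fin_cases i <;> simp [Fin.sum_univ_three] <;> linarith)
    have h6 := h5 0
    have h7 := h5 1
    have h8 := h5 2
    simp at h6 h7 h8
    ext i
    fin_cases i
    exacts [h0, h1, h7, h8, h6]
  let Φ := (LinearEquiv.ofInjectiveEndo Ψ hinj).toContinuousLinearEquiv
  have hΦ (y) : Φ y = Ψ y := rfl
  have hcomp : Φ.symm ∘ mongeForm α ∘ id = g3 := by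
    ext1 p
    apply Φ.injective
    have hA' (i) : α i 0 = 0 := congrFun hA i
    simp only [Function.comp, id, ContinuousLinearEquiv.apply_symm_apply]
    rw [hΦ, hΨ, mongeForm, mongeLinear_apply, mongeFactor_apply]
    ext i
    fin_cases i <;> simp [g3, hA'] <;> ring
  refine ⟨id, Φ.symm, ContinuousLinearEquiv.refl ℝ _, Φ.symm, contDiff_id, Φ.symm.contDiff,
    rfl, map_zero _, hasFDerivAt_id _, Φ.symm.hasFDerivAt, fun k _ => ?_⟩
  rw [hcomp]

/-- The locus swept out by `2 (c² A + a c X + b c Y)` over the unit cylinder. -/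
lemma curvLocus_eq {α : Matrix (Fin 3) (Fin 3) ℝ} {Q : Fin 3 → (Fin 3 → ℝ) → ℝ}
    (hQ : ∀ i p, Q i p = α i 0 * p 2 ^ 2 + α i 1 * p 0 * p 2 + α i 2 * p 1 * p 2) :
    curvLocus Q = {v | ∃ a b c : ℝ, a ^ 2 + b ^ 2 = 1 ∧
      v = (2 * c ^ 2) • α.col 0 + (2 * c * a) • α.col 1 + (2 * c * b) • α.col 2} := by
  have (a b c : ℝ) : ![2 * Q 0 ![a, b, c], 2 * Q 1 ![a, b, c], 2 * Q 2 ![a, b, c]] =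
      (2 * c ^ 2) • α.col 0 + (2 * c * a) • α.col 1 + (2 * c * b) • α.col 2 := by
    ext i
    fin_cases i <;> simp [hQ] <;> ring
  simp only [curvLocus, this]

lemma IsPlanar.exists_locus_eq {α : Matrix (Fin 3) (Fin 3) ℝ} (h : IsPlanar α) :
    ∃ W : Submodule ℝ (Fin 3 → ℝ), Module.finrank ℝ W = 2 ∧
      {v | ∃ a b c : ℝ, a ^ 2 + b ^ 2 = 1 ∧
        v = (2 * c ^ 2) • α.col 0 + (2 * c * a) • α.col 1 + (2 * c * b) • α.col 2} =
          (W : Set (Fin 3 → ℝ)) := by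
  obtain ⟨hA, hli⟩ := h
  refine ⟨Submodule.span ℝ (Set.range ![α.col 1, α.col 2]), by
    simpa using finrank_span_eq_card hli, ?_⟩
  ext v
  rw [Matrix.range_cons, Matrix.range_cons, Matrix.range_empty, Set.union_empty,
    Set.singleton_union, SetLike.mem_coe, Submodule.mem_span_pair, hA]
  constructor
  · rintro ⟨a, b, c, -, rfl⟩
    exact ⟨2 * c * a, 2 * c * b, by simp⟩
  · rintro ⟨p, q, rfl⟩
    rcases eq_or_ne (p ^ 2 + q ^ 2) 0 with h0 | h0
    · have hp : p = 0 := by nlinarith [sq_nonneg p, sq_nonneg q]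
      have hq : q = 0 := by nlinarith [sq_nonneg p, sq_nonneg q]
      exact ⟨1, 0, 0, by norm_num, by simp [hp, hq]⟩
    · have hs : Real.sqrt (p ^ 2 + q ^ 2) ^ 2 = p ^ 2 + q ^ 2 := Real.sq_sqrt (by positivity)
      set s := Real.sqrt (p ^ 2 + q ^ 2)
      have hs0 : s ≠ 0 := by
        rintro h
        rw [h] at hs
        exact h0 (by linarith)
      refine ⟨p / s, q / s, s / 2, ?_, ?_⟩
      · field_simp
        exact hs.symm
      · have h1 : 2 * (s / 2) * (p / s) = p := by field_simp
        have h2 : 2 * (s / 2) * (q / s) = q := by field_simp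
        rw [h1, h2]
        simp

lemma IsPlanar.of_locus_eq {α : Matrix (Fin 3) (Fin 3) ℝ} {W : Submodule ℝ (Fin 3 → ℝ)}
    (hW : Module.finrank ℝ W = 2)
    (h : {v | ∃ a b c : ℝ, a ^ 2 + b ^ 2 = 1 ∧
        v = (2 * c ^ 2) • α.col 0 + (2 * c * a) • α.col 1 + (2 * c * b) • α.col 2} =
          (W : Set (Fin 3 → ℝ))) : IsPlanar α := by
  have hmem (v) : v ∈ W ↔ ∃ a b c : ℝ, a ^ 2 + b ^ 2 = 1 ∧
      v = (2 * c ^ 2) • α.col 0 + (2 * c * a) • α.col 1 + (2 * c * b) • α.col 2 := by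
    rw [← SetLike.mem_coe, ← h]
    rfl
  clear h
  set A := α.col 0 with hA
  set X := α.col 1
  set Y := α.col 2
  have hXm := (hmem _).2 ⟨1, 0, 1, by norm_num, rfl⟩
  have hXm' := (hmem _).2 ⟨-1, 0, 1, by norm_num, rfl⟩
  have hYm := (hmem _).2 ⟨0, 1, 1, by norm_num, rfl⟩
  have hYm' := (hmem _).2 ⟨0, -1, 1, by norm_num, rfl⟩
  have hAW : A ∈ W := by
    convert W.smul_mem (1 / 4 : ℝ) (W.add_mem hXm hXm') using 1
    module
  have hXW : X ∈ W := by
    convert W.smul_mem (1 / 4 : ℝ) (W.sub_mem hXm hXm') using 1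
    module
  have hYW : Y ∈ W := by
    convert W.smul_mem (1 / 4 : ℝ) (W.sub_mem hYm hYm') using 1
    module
  obtain ⟨u, v, hAuv⟩ : ∃ u v : ℝ, A = u • X + v • Y := by
    obtain ⟨a, b, c, -, h⟩ := (hmem _).1 (W.neg_mem hAW)
    have hc : 1 + 2 * c ^ 2 ≠ 0 := by positivity
    refine ⟨-(2 * c * a) / (1 + 2 * c ^ 2), -(2 * c * b) / (1 + 2 * c ^ 2), ?_⟩
    ext i
    have := congrFun h i
    simp at this ⊢
    field_simp
    linarith
  have hspan : Submodule.span ℝ (Set.range ![X, Y]) = W := by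
    rw [Matrix.range_cons, Matrix.range_cons, Matrix.range_empty, Set.union_empty,
      Set.singleton_union]
    ext w
    rw [Submodule.mem_span_pair]
    constructor
    · rintro ⟨p, q, rfl⟩
      exact W.add_mem (W.smul_mem _ hXW) (W.smul_mem _ hYW)
    · intro hw
      obtain ⟨a, b, c, -, rfl⟩ := (hmem _).1 hw
      refine ⟨2 * c ^ 2 * u + 2 * c * a, 2 * c ^ 2 * v + 2 * c * b, ?_⟩
      rw [hAuv]
      module
  have hli : LinearIndependent ℝ ![X, Y] := by
    rw [linearIndependent_iff_card_eq_finrank_span, Set.finrank, hspan, hW]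
    simp
  refine ⟨?_, hli⟩
  by_contra hA0
  have hn : 0 < u ^ 2 + v ^ 2 := by
    by_contra hn
    have hu : u = 0 := by nlinarith [sq_nonneg u, sq_nonneg v]
    have hv : v = 0 := by nlinarith [sq_nonneg u, sq_nonneg v]
    exact hA0 (by rw [← hA, hAuv, hu, hv]; simp)
  set n := u ^ 2 + v ^ 2 with hndef
  obtain ⟨t, ht⟩ : ∃ t, n * t = 2 := ⟨2 / n, by field_simp⟩
  have hm : (-(t * v)) • X + (t * u) • Y ∈ W :=
    W.add_mem (W.smul_mem _ hXW) (W.smul_mem _ hYW)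
  obtain ⟨a, b, c, hab, heq⟩ := (hmem _).1 hm
  rw [hAuv] at heq
  obtain ⟨h1, h2⟩ := LinearIndependent.pair_iff.1 hli
    (2 * c ^ 2 * u + 2 * c * a + t * v) (2 * c ^ 2 * v + 2 * c * b - t * u) (by
      rw [← sub_eq_zero] at heq
      rw [← neg_eq_zero, ← heq]
      module)
  have h3 : n * t ^ 2 + n * (2 * c ^ 2) ^ 2 = 2 * (2 * c ^ 2) := by
    have e1 : 2 * c * a = -(2 * c ^ 2 * u + t * v) := by linarith
    have e2 : 2 * c * b = t * u - 2 * c ^ 2 * v := by linarith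
    have e3 : (2 * c * a) ^ 2 + (2 * c * b) ^ 2 = 4 * c ^ 2 := by
      linear_combination 4 * c ^ 2 * hab
    rw [e1, e2] at e3
    rw [hndef]
    linear_combination e3
  have h4 : n * t ^ 2 = 2 * t := by rw [← ht]; ring
  have ht0 : 0 < t := pos_of_mul_pos_right (by rw [ht]; norm_num) hn.le
  have h5 : 0 ≤ n * (t - 2 * c ^ 2) ^ 2 := by positivity
  have h6 : n * (t - 2 * c ^ 2) ^ 2 =
      n * t ^ 2 + n * (2 * c ^ 2) ^ 2 - 2 * (n * t) * (2 * c ^ 2) := by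
    ring
  rw [ht] at h6
  nlinarith [sq_nonneg c]

/-- For the special Monge form, `𝒜²`-equivalence to `(x,y,xz,yz,0)` is characterised
by the curvature locus being a plane (a 2-dimensional linear subspace of `ℝ³`). -/
theorem A2_equiv_g3_iff_locus_plane
    (α : Matrix (Fin 3) (Fin 3) ℝ) (Q : Fin 3 → (Fin 3 → ℝ) → ℝ)
    (hQ : ∀ i p, Q i p = α i 0 * p 2 ^ 2 + α i 1 * p 0 * p 2 + α i 2 * p 1 * p 2)
    (f : (Fin 3 → ℝ) → (Fin 5 → ℝ))
    (hf : ∀ p, f p = ![p 0, p 1, Q 0 p, Q 1 p, Q 2 p]) :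
    A2Equiv f g3 ↔
      ∃ W : Submodule ℝ (Fin 3 → ℝ), Module.finrank ℝ W = 2 ∧
        curvLocus Q = (W : Set (Fin 3 → ℝ)) := by
  have hfm : f = mongeForm α := by
    ext p i
    rw [hf, mongeForm, mongeLinear_apply, mongeFactor_apply]
    fin_cases i <;> simp [hQ] <;> ring
  rw [hfm, curvLocus_eq hQ]
  exact ⟨fun h => (IsPlanar.of_a2Equiv h).exists_locus_eq,
    fun ⟨_, hW, h⟩ => (IsPlanar.of_locus_eq hW h).a2Equiv⟩
end
end

section
/- Let α be a real 3×3 matrix with entries αᵢⱼ, let Qᵢ(x,y,z) = αᵢ₁ z² + αᵢ₂ xz + αᵢ₃ yz for i = 1,2,3, and let f(x,y,z) = (x, y, Q₁(x,y,z), Q₂(x,y,z), Q₃(x,y,z)). Then f is A²-equivalent to g₄(x,y,z) = (x,y,z²,0,0) if and only if the curvature locus Δ_f is a closed half-line; precisely, if and only if there exist u ∈ ℝ³ with u ≠ 0 and a real number t₀ ≤ 0 such that Δ_f = {t • u : t ∈ ℝ, t ≥ t₀}. -/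
noncomputable section

/-- Second-order chain rule on the diagonal. -/
lemma fderiv_fderiv_comp_diag {E F G : Type*} [NormedAddCommGroup E] [NormedSpace ℝ E]
    [NormedAddCommGroup F] [NormedSpace ℝ F] [NormedAddCommGroup G] [NormedSpace ℝ G]
    {g : F → G} {h : E → F} (hg : ContDiff ℝ (⊤ : ℕ∞) g) (hh : ContDiff ℝ (⊤ : ℕ∞) h) (x v : E) :
    fderiv ℝ (fderiv ℝ (g ∘ h)) x v v =
      fderiv ℝ (fderiv ℝ g) (h x) (fderiv ℝ h x v) (fderiv ℝ h x v) +
        fderiv ℝ g (h x) (fderiv ℝ (fderiv ℝ h) x v v) := by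
  have hgd : Differentiable ℝ g := hg.differentiable (by simp)
  have hhd : Differentiable ℝ h := hh.differentiable (by simp)
  have hgd' : Differentiable ℝ (fderiv ℝ g) :=
    (contDiff_infty_iff_fderiv.1 hg).2.differentiable (by simp)
  have hhd' : Differentiable ℝ (fderiv ℝ h) :=
    (contDiff_infty_iff_fderiv.1 hh).2.differentiable (by simp)
  have e : fderiv ℝ (g ∘ h) = fun y => (fderiv ℝ g (h y)).comp (fderiv ℝ h y) :=
    funext fun y => fderiv_comp y (hgd _) (hhd _)
  have key := ((hgd' (h x)).hasFDerivAt.comp x (hhd x).hasFDerivAt).clm_comp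
    (hhd' x).hasFDerivAt
  rw [(key.congr_of_eventuallyEq (Filter.Eventually.of_forall fun y => congrFun e y)).fderiv]
  simp [add_comm]

/-- The first two derivatives at `0` along `v` of a map that is a quadratic polynomial on the
line spanned by `v`. -/
lemma fderiv_of_quadratic_on_line {E F : Type*} [NormedAddCommGroup E] [NormedSpace ℝ E]
    [NormedAddCommGroup F] [NormedSpace ℝ F] {f : E → F} (hf : ContDiff ℝ (⊤ : ℕ∞) f)
    {v : E} {a b : F} (h : ∀ t : ℝ, f (t • v) = t • a + t ^ 2 • b) :
    fderiv ℝ f 0 v = a ∧ fderiv ℝ (fderiv ℝ f) 0 v v = (2 : ℝ) • b := by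
  have hfd : Differentiable ℝ f := hf.differentiable (by simp)
  have hfd' : Differentiable ℝ (fderiv ℝ f) :=
    (contDiff_infty_iff_fderiv.1 hf).2.differentiable (by simp)
  have hl : ∀ t : ℝ, HasDerivAt (fun t : ℝ => t • v) v t := fun t => by
    simpa using (hasDerivAt_id t).smul_const v
  have h1 : ∀ t : ℝ, fderiv ℝ f (t • v) v = a + (2 * t) • b := fun t => by
    have A := (hfd (t • v)).hasFDerivAt.comp_hasDerivAt t (hl t)
    have B : HasDerivAt (fun t : ℝ => t • a + t ^ 2 • b) (a + (2 * t) • b) t := by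
      simpa using ((hasDerivAt_id t).smul_const a).fun_add ((hasDerivAt_pow 2 t).smul_const b)
    have e : f ∘ (fun t : ℝ => t • v) = fun t : ℝ => t • a + t ^ 2 • b := funext h
    rw [e] at A
    exact A.unique B
  refine ⟨by simpa using h1 0, ?_⟩
  have A : HasDerivAt (fun t : ℝ => fderiv ℝ f (t • v)) (fderiv ℝ (fderiv ℝ f) 0 v) 0 := by
    have hd : HasFDerivAt (fderiv ℝ f) (fderiv ℝ (fderiv ℝ f) 0) ((0 : ℝ) • v) := by
      rw [zero_smul]; exact (hfd' 0).hasFDerivAt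
    exact hd.comp_hasDerivAt (0 : ℝ) (hl 0)
  have A' : HasDerivAt (fun t : ℝ => fderiv ℝ f (t • v) v) (fderiv ℝ (fderiv ℝ f) 0 v v) 0 := by
    simpa using A.clm_apply (hasDerivAt_const (0 : ℝ) v)
  have B : HasDerivAt (fun t : ℝ => a + (2 * t) • b) ((2 : ℝ) • b) 0 := by
    simpa using (((hasDerivAt_id (0 : ℝ)).const_mul 2).smul_const b).const_add a
  rw [funext h1] at A'
  exact A'.unique B

/-- Necessary condition: the quadratic part of a germ `𝒜²`-equivalent to `g4` has a nonzero
`z²`-coefficient vector, and all its other coefficient vectors are multiples of it. -/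
lemma coeff_proportional_of_A2Equiv_g4
    (α : Matrix (Fin 3) (Fin 3) ℝ) (Q : Fin 3 → (Fin 3 → ℝ) → ℝ)
    (hQ : ∀ i p, Q i p = α i 0 * p 2 ^ 2 + α i 1 * p 0 * p 2 + α i 2 * p 1 * p 2)
    (f : (Fin 3 → ℝ) → (Fin 5 → ℝ))
    (hf : ∀ p, f p = ![p 0, p 1, Q 0 p, Q 1 p, Q 2 p]) (h : A2Equiv f g4) :
    (∃ i, α i 0 ≠ 0) ∧ ∃ s t : ℝ, ∀ i, α i 1 = s * α i 0 ∧ α i 2 = t * α i 0 := by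
  obtain ⟨ψ, φ, P, A, hψ, hφ, hψ0, -, hP, hA, hjet⟩ := h
  have hfc : ContDiff ℝ (⊤ : ℕ∞) f := by
    have : f = fun p => ![p 0, p 1, Q 0 p, Q 1 p, Q 2 p] := funext hf
    rw [this, contDiff_pi]
    intro i
    fin_cases i <;> simp [hQ] <;> fun_prop
  have hgc : ContDiff ℝ (⊤ : ℕ∞) g4 := by
    rw [contDiff_pi]
    intro i
    fin_cases i <;> simp [g4] <;> fun_prop
  have hf0 : f 0 = 0 := by
    ext i; fin_cases i <;> simp [hf, hQ]
  have hfl : ∀ w : Fin 3 → ℝ, fderiv ℝ f 0 w = ![w 0, w 1, 0, 0, 0] ∧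
      fderiv ℝ (fderiv ℝ f) 0 w w = (2 : ℝ) • ![0, 0, Q 0 w, Q 1 w, Q 2 w] := fun w => by
    refine fderiv_of_quadratic_on_line hfc fun t => ?_
    ext i; fin_cases i <;> simp [hf, hQ] <;> ring
  have hgl : ∀ w : Fin 3 → ℝ, fderiv ℝ g4 0 w = ![w 0, w 1, 0, 0, 0] ∧
      fderiv ℝ (fderiv ℝ g4) 0 w w = (2 : ℝ) • ![0, 0, w 2 ^ 2, 0, 0] := fun w => by
    refine fderiv_of_quadratic_on_line hgc fun t => ?_
    ext i; fin_cases i <;> simp [g4]; ring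
  have hfψ : ContDiff ℝ (⊤ : ℕ∞) (f ∘ ψ) := hfc.comp hψ
  have hDfψ : ∀ v, fderiv ℝ (f ∘ ψ) 0 v = ![P v 0, P v 1, 0, 0, 0] := fun v => by
    rw [fderiv_comp 0 (hfc.differentiable (by simp) _) (hψ.differentiable (by simp) _), hψ0,
      hP.fderiv]
    simp [(hfl _).1]
  have hA0 : fderiv ℝ φ ((f ∘ ψ) 0) = (A : (Fin 5 → ℝ) →L[ℝ] (Fin 5 → ℝ)) := by
    simp [hψ0, hf0, hA.fderiv]
  have h1 : ∀ v : Fin 3 → ℝ, A ![P v 0, P v 1, 0, 0, 0] = ![v 0, v 1, 0, 0, 0] := fun v => by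
    have e := congrArg (fun m => m (fun _ => v)) (hjet 1 (by norm_num))
    simp only [iteratedFDeriv_one_apply] at e
    rw [fderiv_comp 0 (hφ.differentiable (by simp) _) (hfψ.differentiable (by simp) _), hA0,
      (hgl v).1] at e
    simpa [hDfψ] using e
  set S : (Fin 5 → ℝ) → (Fin 5 → ℝ) := fun y => A.symm (fderiv ℝ (fderiv ℝ φ) 0 y y) with hS
  set b : Fin 5 → ℝ := A.symm ![0, 0, 1, 0, 0] with hb
  have h2 : ∀ w : Fin 3 → ℝ, ∃ q : Fin 3 → ℝ,
      S ![w 0, w 1, 0, 0, 0] + ((2 : ℝ) • ![0, 0, Q 0 w, Q 1 w, Q 2 w] +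
        ![q 0, q 1, 0, 0, 0]) = (2 * (P.symm w 2) ^ 2) • b := fun w => by
    refine ⟨fderiv ℝ (fderiv ℝ ψ) 0 (P.symm w) (P.symm w), ?_⟩
    have e := congrArg (fun m => m (fun _ => P.symm w)) (hjet 2 le_rfl)
    simp only [iteratedFDeriv_two_apply] at e
    rw [fderiv_fderiv_comp_diag hφ hfψ, hA0, fderiv_fderiv_comp_diag hfc hψ, hDfψ, hψ0,
      hP.fderiv, (hgl _).2] at e
    have e' := congrArg A.symm e
    have e3 : (![0, 0, (P.symm w 2) ^ 2, 0, 0] : Fin 5 → ℝ) =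
        ((P.symm w 2) ^ 2) • ![0, 0, 1, 0, 0] := by
      simp
    rw [e3] at e'
    simpa [-Matrix.smul_cons, (hfl _).1, (hfl _).2, hψ0, hf0, hS, hb, mul_smul] using e'
  have h3 : ∀ w : Fin 3 → ℝ, ∀ i : Fin 3,
      S ![w 0, w 1, 0, 0, 0] (Fin.natAdd 2 i) + 2 * Q i w =
        2 * (P.symm w 2) ^ 2 * b (Fin.natAdd 2 i) := fun w i => by
    obtain ⟨q, hq⟩ := h2 w
    have := congrFun hq (Fin.natAdd 2 i)
    fin_cases i <;> simpa using this
  have hS0 : S ![0, 0, 0, 0, 0] = 0 := by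
    have : (![0, 0, 0, 0, 0] : Fin 5 → ℝ) = 0 := by ext i; fin_cases i <;> rfl
    simp [this, hS]
  set μ : ℝ := P.symm ![0, 0, 1] 2 with hμ
  have hμ0 : μ ≠ 0 := fun h0 => by
    have e := h1 (P.symm ![0, 0, 1])
    have z : (![0, 0, 0, 0, 0] : Fin 5 → ℝ) = 0 := by ext i; fin_cases i <;> rfl
    simp only [ContinuousLinearEquiv.apply_symm_apply, Matrix.cons_val_zero, Matrix.cons_val_one,
      z, map_zero] at e
    have e0 := congrFun e 0
    have e1 := congrFun e 1
    have : P.symm ![0, 0, 1] = 0 := by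
      ext i
      fin_cases i
      · simpa using e0.symm
      · simpa using e1.symm
      · exact h0
    have := congrFun ((map_eq_zero_iff P.symm P.symm.injective).1 this) 2
    simp at this
  have hc0 : ∀ i, α i 0 = μ ^ 2 * b (Fin.natAdd 2 i) := fun i => by
    have e := h3 ![0, 0, 1] i
    simp [hS0, hQ] at e
    linarith
  have hb0 : ∃ i : Fin 3, b (Fin.natAdd 2 i) ≠ 0 := by
    by_contra! hz
    have e := h1 (P.symm ![b 0, b 1, 0])
    have hbe : (![b 0, b 1, 0, 0, 0] : Fin 5 → ℝ) = b := by
      ext i; fin_cases i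
      · rfl
      · rfl
      · exact (hz 0).symm
      · exact (hz 1).symm
      · exact (hz 2).symm
    simp only [ContinuousLinearEquiv.apply_symm_apply, Matrix.cons_val_zero, Matrix.cons_val_one,
      hbe] at e
    rw [hb, ContinuousLinearEquiv.apply_symm_apply] at e
    have := congrFun e 2
    simp at this
  have hsplit : ∀ (w : Fin 3 → ℝ) (c : ℝ), P.symm (w + c • (![0, 0, 1] : Fin 3 → ℝ)) 2 = P.symm w 2 + c * μ :=
    fun w c => by
      rw [map_add, map_smul]; rfl
  have hmul : ∀ (w : Fin 3 → ℝ), w 2 = 0 → ∀ i,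
      α i 1 * w 0 + α i 2 * w 1 = 2 * P.symm w 2 / μ * α i 0 := fun w hw i => by
    have ep := h3 (w + (1 : ℝ) • ![0, 0, 1]) i
    have em := h3 (w + (-1 : ℝ) • ![0, 0, 1]) i
    rw [hsplit] at ep em
    have e0 : ∀ c : ℝ, (w + c • (![0, 0, 1] : Fin 3 → ℝ)) 0 = w 0 := fun c => by simp [-Matrix.smul_cons]
    have e1 : ∀ c : ℝ, (w + c • (![0, 0, 1] : Fin 3 → ℝ)) 1 = w 1 := fun c => by simp [-Matrix.smul_cons]
    have e2 : ∀ c : ℝ, (w + c • (![0, 0, 1] : Fin 3 → ℝ)) 2 = c := fun c => by simp [-Matrix.smul_cons, hw]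
    rw [hQ, e0, e1, e2] at ep em
    have : 2 * P.symm w 2 / μ * α i 0 = 2 * P.symm w 2 * μ * b (Fin.natAdd 2 i) := by
      rw [hc0]; field_simp
    rw [this]
    linear_combination (ep - em) / 4
  refine ⟨?_, 2 * P.symm ![1, 0, 0] 2 / μ, 2 * P.symm ![0, 1, 0] 2 / μ, fun i => ⟨?_, ?_⟩⟩
  · obtain ⟨i, hi⟩ := hb0
    exact ⟨i, by rw [hc0]; exact mul_ne_zero (pow_ne_zero 2 hμ0) hi⟩
  · simpa using hmul ![1, 0, 0] (by simp) i
  · simpa using hmul ![0, 1, 0] (by simp) i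

/-- The linear automorphism of `ℝ⁵ = ℝ² × ℝ³` acting as the identity on `ℝ²` and by `M`
on `ℝ³`. -/
def idProdEquiv (M : (Fin 3 → ℝ) ≃L[ℝ] (Fin 3 → ℝ)) : (Fin 5 → ℝ) ≃L[ℝ] (Fin 5 → ℝ) :=
  LinearEquiv.toContinuousLinearEquiv
    { toFun := fun p => ![p 0, p 1, M ![p 2, p 3, p 4] 0, M ![p 2, p 3, p 4] 1,
        M ![p 2, p 3, p 4] 2]
      invFun := fun p => ![p 0, p 1, M.symm ![p 2, p 3, p 4] 0, M.symm ![p 2, p 3, p 4] 1,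
        M.symm ![p 2, p 3, p 4] 2]
      map_add' := fun p q => by
        have : (![p 2 + q 2, p 3 + q 3, p 4 + q 4] : Fin 3 → ℝ) =
          ![p 2, p 3, p 4] + ![q 2, q 3, q 4] := by simp
        ext i
        fin_cases i <;> simp only [Pi.add_apply, this, map_add] <;> simp
      map_smul' := fun c p => by
        have : (![c * p 2, c * p 3, c * p 4] : Fin 3 → ℝ) = c • ![p 2, p 3, p 4] := by simp
        ext i
        fin_cases i <;> simp only [Pi.smul_apply, smul_eq_mul, this, map_smul] <;> simp
      left_inv := fun p => by
        have : ∀ v : Fin 3 → ℝ, ![v 0, v 1, v 2] = v := fun v => by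
          ext i; fin_cases i <;> rfl
        ext i
        fin_cases i <;> simp [this]
      right_inv := fun p => by
        have : ∀ v : Fin 3 → ℝ, ![v 0, v 1, v 2] = v := fun v => by
          ext i; fin_cases i <;> rfl
        ext i
        fin_cases i <;> simp [this] }

lemma idProdEquiv_apply (M : (Fin 3 → ℝ) ≃L[ℝ] (Fin 3 → ℝ)) (p : Fin 5 → ℝ) :
    idProdEquiv M p = ![p 0, p 1, M ![p 2, p 3, p 4] 0, M ![p 2, p 3, p 4] 1,
      M ![p 2, p 3, p 4] 2] := rfl

/-- The shear `(x, y, z) ↦ (x, y, z - (s x + t y) / 2)` completing the square. -/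
def shearEquiv (s t : ℝ) : (Fin 3 → ℝ) ≃L[ℝ] (Fin 3 → ℝ) :=
  LinearEquiv.toContinuousLinearEquiv
    { toFun := fun p => ![p 0, p 1, p 2 - (s * p 0 + t * p 1) / 2]
      invFun := fun p => ![p 0, p 1, p 2 + (s * p 0 + t * p 1) / 2]
      map_add' := fun p q => by
        ext i; fin_cases i <;> simp; ring
      map_smul' := fun c p => by
        ext i; fin_cases i <;> simp; ring
      left_inv := fun p => by
        ext i; fin_cases i <;> simp
      right_inv := fun p => by
        ext i; fin_cases i <;> simp }

lemma shearEquiv_apply (s t : ℝ) (p : Fin 3 → ℝ) :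
    shearEquiv s t p = ![p 0, p 1, p 2 - (s * p 0 + t * p 1) / 2] := rfl

/-- Sufficient condition: completing the square brings the germ to the form `g4`. -/
lemma A2Equiv_g4_of_coeff_proportional
    (α : Matrix (Fin 3) (Fin 3) ℝ) (Q : Fin 3 → (Fin 3 → ℝ) → ℝ)
    (hQ : ∀ i p, Q i p = α i 0 * p 2 ^ 2 + α i 1 * p 0 * p 2 + α i 2 * p 1 * p 2)
    (f : (Fin 3 → ℝ) → (Fin 5 → ℝ))
    (hf : ∀ p, f p = ![p 0, p 1, Q 0 p, Q 1 p, Q 2 p])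
    (h0 : ∃ i, α i 0 ≠ 0) (s t : ℝ) (hst : ∀ i, α i 1 = s * α i 0 ∧ α i 2 = t * α i 0) :
    A2Equiv f g4 := by
  have hc : (fun i => α i 0) ≠ (0 : Fin 3 → ℝ) := fun h => by
    obtain ⟨i, hi⟩ := h0
    exact hi (congrFun h i)
  have he : (![1, 0, 0] : Fin 3 → ℝ) ≠ 0 := fun h => by simpa using congrFun h 0
  obtain ⟨M, hM⟩ := SeparatingDual.exists_continuousLinearEquiv_apply_eq (R := ℝ) hc he
  refine ⟨shearEquiv s t,
    fun p => idProdEquiv M p + ((s * p 0 + t * p 1) ^ 2 / 4) • ![0, 0, 1, 0, 0],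
    shearEquiv s t, idProdEquiv M, (shearEquiv s t).contDiff, ?_, map_zero _, ?_,
    (shearEquiv s t).hasFDerivAt, ?_, fun k _ => ?_⟩
  · exact (idProdEquiv M).contDiff.add
      (ContDiff.smul (f := fun p : Fin 5 → ℝ => (s * p 0 + t * p 1) ^ 2 / 4) (by fun_prop)
        contDiff_const)
  · simp
  · have hl : HasFDerivAt (fun p : Fin 5 → ℝ => s * p 0 + t * p 1)
        (s • ContinuousLinearMap.proj (R := ℝ) (φ := fun _ : Fin 5 => ℝ) 0 +
          t • ContinuousLinearMap.proj (R := ℝ) (φ := fun _ : Fin 5 => ℝ) 1) 0 :=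
      ((hasFDerivAt_apply 0 0).const_mul s).add ((hasFDerivAt_apply 1 0).const_mul t)
    have hq : HasFDerivAt (fun p : Fin 5 → ℝ => (s * p 0 + t * p 1) ^ 2 / 4)
        (0 : (Fin 5 → ℝ) →L[ℝ] ℝ) 0 := by
      have := (hl.pow 2).mul_const (1 / 4 : ℝ)
      simpa [div_eq_mul_inv] using this
    exact ((idProdEquiv M).hasFDerivAt.fun_add
      (hq.smul_const (![0, 0, 1, 0, 0] : Fin 5 → ℝ))).congr_fderiv (by ext v : 1; simp)
  · congr 1
    funext p
    have hv : (![Q 0 (shearEquiv s t p), Q 1 (shearEquiv s t p), Q 2 (shearEquiv s t p)] :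
        Fin 3 → ℝ) = (p 2 ^ 2 - (s * p 0 + t * p 1) ^ 2 / 4) • fun i => α i 0 := by
      ext i
      fin_cases i <;> simp [hQ, shearEquiv_apply, (hst _).1, (hst _).2] <;> ring
    have hMv : M ![Q 0 (shearEquiv s t p), Q 1 (shearEquiv s t p), Q 2 (shearEquiv s t p)] =
        (p 2 ^ 2 - (s * p 0 + t * p 1) ^ 2 / 4) • ![1, 0, 0] := by
      rw [hv, map_smul, hM]
    have h5 : idProdEquiv M (f (shearEquiv s t p)) =
        ![p 0, p 1, p 2 ^ 2 - (s * p 0 + t * p 1) ^ 2 / 4, 0, 0] := by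
      rw [idProdEquiv_apply, hf]
      simp only [Matrix.cons_val]
      rw [hMv]
      ext i; fin_cases i <;> simp [shearEquiv_apply]
    simp only [Function.comp_apply, h5]
    ext i
    fin_cases i <;> simp [g4, hf, shearEquiv_apply]

/-- The curvature locus is a closed half-line exactly when the `z²`-coefficient vector is
nonzero and the other coefficient vectors are multiples of it. -/
lemma curvLocus_half_line_iff
    (α : Matrix (Fin 3) (Fin 3) ℝ) (Q : Fin 3 → (Fin 3 → ℝ) → ℝ)
    (hQ : ∀ i p, Q i p = α i 0 * p 2 ^ 2 + α i 1 * p 0 * p 2 + α i 2 * p 1 * p 2) :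
    (∃ (u : Fin 3 → ℝ) (t₀ : ℝ), u ≠ 0 ∧ t₀ ≤ 0 ∧
        curvLocus Q = {v | ∃ t : ℝ, t₀ ≤ t ∧ v = t • u}) ↔
      (∃ i, α i 0 ≠ 0) ∧ ∃ s t : ℝ, ∀ i, α i 1 = s * α i 0 ∧ α i 2 = t * α i 0 := by
  have hmem : ∀ v : Fin 3 → ℝ, v ∈ curvLocus Q ↔ ∃ a b c : ℝ, a ^ 2 + b ^ 2 = 1 ∧
      ∀ i, v i = 2 * (α i 0 * c ^ 2 + α i 1 * a * c + α i 2 * b * c) := fun v => by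
    simp [curvLocus, hQ, funext_iff, Fin.forall_fin_succ]
  constructor
  · rintro ⟨u, t₀, hu, -, hloc⟩
    have hline : ∀ a b c : ℝ, a ^ 2 + b ^ 2 = 1 → ∃ t : ℝ, t₀ ≤ t ∧
        ∀ i, 2 * (α i 0 * c ^ 2 + α i 1 * a * c + α i 2 * b * c) = t * u i := fun a b c h => by
      have : (fun i => 2 * (α i 0 * c ^ 2 + α i 1 * a * c + α i 2 * b * c)) ∈ curvLocus Q :=
        (hmem _).2 ⟨a, b, c, h, fun i => rfl⟩
      rw [hloc] at this
      obtain ⟨t, ht, e⟩ := this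
      exact ⟨t, ht, fun i => congrFun e i⟩
    obtain ⟨p, -, hp⟩ := hline 1 0 1 (by norm_num)
    obtain ⟨m, -, hm⟩ := hline 1 0 (-1) (by norm_num)
    obtain ⟨q, -, hq⟩ := hline 0 1 1 (by norm_num)
    have h0 : ∀ i, α i 0 = (p + m) / 4 * u i := fun i => by
      linear_combination (hp i + hm i) / 4
    obtain ⟨j, hj⟩ := Function.ne_iff.1 hu
    have hk : p + m ≠ 0 := fun hz => by
      have hz0 : ∀ i, α i 0 = 0 := fun i => by rw [h0, hz]; ring
      have hM : ((|t₀| + 1) • u) ∈ curvLocus Q := by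
        rw [hloc]; exact ⟨_, by linarith [le_abs_self t₀], rfl⟩
      obtain ⟨a, b, c, hab, e⟩ := (hmem _).1 hM
      obtain ⟨t, ht, e'⟩ := hline a b (-c) hab
      have h1 := e j
      have h2 := e' j
      rw [hz0] at h1 h2
      have h3 : (|t₀| + 1 + t) * u j = 0 := by
        simp only [Pi.smul_apply, smul_eq_mul] at h1
        linear_combination h1 - h2
      rcases mul_eq_zero.1 h3 with h | h
      · linarith [neg_abs_le t₀]
      · exact hj h
    refine ⟨⟨j, ?_⟩, (p - m) / (p + m), (2 * q - (p + m)) / (p + m), fun i => ⟨?_, ?_⟩⟩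
    · rw [h0]; exact mul_ne_zero (div_ne_zero hk (by norm_num)) hj
    · have : (p - m) / (p + m) * α i 0 = (p - m) / 4 * u i := by
        rw [h0]; field_simp
      rw [this]
      linear_combination (hp i - hm i) / 4
    · have : (2 * q - (p + m)) / (p + m) * α i 0 = (2 * q - (p + m)) / 4 * u i := by
        rw [h0]; field_simp
      rw [this]
      linear_combination hq i / 2 - (hp i + hm i) / 4
  · rintro ⟨⟨j, hj⟩, s, t, hst⟩
    refine ⟨fun i => α i 0, -(s ^ 2 + t ^ 2) / 2, fun h => hj (congrFun h j), by
      nlinarith [sq_nonneg s, sq_nonneg t], ?_⟩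
    ext v
    rw [hmem]
    simp only [Set.mem_ofPred_eq, (hst _).1, (hst _).2, funext_iff, Pi.smul_apply, smul_eq_mul]
    constructor
    · rintro ⟨a, b, c, hab, hv⟩
      refine ⟨2 * (c ^ 2 + (s * a + t * b) * c), ?_, fun i => by rw [hv]; ring⟩
      have : (s * a + t * b) ^ 2 ≤ s ^ 2 + t ^ 2 := by
        have : s ^ 2 + t ^ 2 - (s * a + t * b) ^ 2 = (s * b - t * a) ^ 2 := by
          linear_combination (-(s ^ 2 + t ^ 2)) * hab
        nlinarith [sq_nonneg (s * b - t * a)]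
      nlinarith [sq_nonneg (2 * c + (s * a + t * b))]
    · rintro ⟨r, hr, hv⟩
      obtain ⟨a, b, hab, hR⟩ : ∃ a b : ℝ, a ^ 2 + b ^ 2 = 1 ∧
          (s * a + t * b) ^ 2 = s ^ 2 + t ^ 2 := by
        by_cases hz : s ^ 2 + t ^ 2 = 0
        · have hs : s = 0 := by nlinarith [sq_nonneg s, sq_nonneg t]
          have ht : t = 0 := by nlinarith [sq_nonneg s, sq_nonneg t]
          exact ⟨1, 0, by norm_num, by simp [hs, ht]⟩
        · have hpos : 0 ≤ s ^ 2 + t ^ 2 := by positivity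
          have hsq := Real.sq_sqrt hpos
          have hne : √(s ^ 2 + t ^ 2) ≠ 0 := fun h => hz (by rw [← hsq, h]; ring)
          refine ⟨s / √(s ^ 2 + t ^ 2), t / √(s ^ 2 + t ^ 2), ?_, ?_⟩
          · rw [div_pow, div_pow, hsq]; field_simp
          · have : s * (s / √(s ^ 2 + t ^ 2)) + t * (t / √(s ^ 2 + t ^ 2)) =
                √(s ^ 2 + t ^ 2) := by
              field_simp; rw [hsq]
            rw [this, hsq]
      have hd : 0 ≤ (s * a + t * b) ^ 2 + 2 * r := by rw [hR]; linarith
      refine ⟨a, b, (-(s * a + t * b) + √((s * a + t * b) ^ 2 + 2 * r)) / 2, hab, fun i => ?_⟩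
      rw [hv]
      linear_combination (-α i 0 / 2) * Real.sq_sqrt hd

/-- For the special Monge form, `𝒜²`-equivalence to `(x,y,z²,0,0)` is characterised
by the curvature locus being a closed half-line `{t • u : t ≥ t₀}` with `t₀ ≤ 0`. -/
theorem A2_equiv_g4_iff_locus_half_line
    (α : Matrix (Fin 3) (Fin 3) ℝ) (Q : Fin 3 → (Fin 3 → ℝ) → ℝ)
    (hQ : ∀ i p, Q i p = α i 0 * p 2 ^ 2 + α i 1 * p 0 * p 2 + α i 2 * p 1 * p 2)
    (f : (Fin 3 → ℝ) → (Fin 5 → ℝ))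
    (hf : ∀ p, f p = ![p 0, p 1, Q 0 p, Q 1 p, Q 2 p]) :
    A2Equiv f g4 ↔
      ∃ (u : Fin 3 → ℝ) (t₀ : ℝ), u ≠ 0 ∧ t₀ ≤ 0 ∧
        curvLocus Q = {v | ∃ t : ℝ, t₀ ≤ t ∧ v = t • u} := by
  rw [curvLocus_half_line_iff α Q hQ]
  exact ⟨coeff_proportional_of_A2Equiv_g4 α Q hQ f hf, fun ⟨h0, s, t, hst⟩ =>
    A2Equiv_g4_of_coeff_proportional α Q hQ f hf h0 s t hst⟩
end
end

section
/- Let f(x,y,z) = (x, y, x² + z², xy + xz, y²). Then (a) f is A²-equivalent to g₂(x,y,z) = (x,y,z²,xz,0), and (b) the curvature locus Δ_f = {(2a² + 2c², 2ab + 2ac, 2b²) ∈ ℝ³ : a, b, c ∈ ℝ, a² + b² = 1} is not contained in any 2-dimensional affine subspace of ℝ³. -/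
noncomputable section

/-- The quadratic shear of `ℝ⁵` removing the monomials `x²`, `xy`, `y²` from the last three
coordinates of a map of the form `(x, y, Q₁, Q₂, Q₃)`. -/
def targetShear (q : Fin 5 → ℝ) : Fin 5 → ℝ :=
  ![q 0, q 1, q 2 - q 0 ^ 2, q 3 - q 0 * q 1, q 4 - q 1 ^ 2]

theorem contDiff_targetShear {n : WithTop ℕ∞} : ContDiff ℝ n targetShear := by
  rw [contDiff_pi]
  intro i
  fin_cases i <;> simp [targetShear] <;> fun_prop

theorem hasFDerivAt_targetShear_zero :
    HasFDerivAt targetShear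
      (ContinuousLinearEquiv.refl ℝ (Fin 5 → ℝ) : (Fin 5 → ℝ) →L[ℝ] (Fin 5 → ℝ)) 0 := by
  have hc (i : Fin 5) : HasFDerivAt (fun q : Fin 5 → ℝ => q i)
      (ContinuousLinearMap.proj (R := ℝ) (φ := fun _ : Fin 5 => ℝ) i) 0 := hasFDerivAt_apply i 0
  rw [hasFDerivAt_pi']
  intro i
  fin_cases i
  · exact hc 0
  · exact hc 1
  · exact ((hc 2).sub ((hc 0).pow 2)).congr_fderiv (by ext; simp)
  · exact ((hc 3).sub ((hc 0).mul (hc 1))).congr_fderiv (by ext; simp)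
  · exact ((hc 4).sub ((hc 1).pow 2)).congr_fderiv (by ext; simp)

/-- The map `f(x,y,z) = (x, y, x² + z², xy + xz, y²)` is `𝒜²`-equivalent to
`(x,y,z²,xz,0)`, yet its curvature locus is not contained in any 2-dimensional
affine subspace of `ℝ³` (it is a substantial surface). -/
theorem counterexample_without_special_form
    (f : (Fin 3 → ℝ) → (Fin 5 → ℝ))
    (hf : ∀ p, f p = ![p 0, p 1, p 0 ^ 2 + p 2 ^ 2, p 0 * p 1 + p 0 * p 2, p 1 ^ 2]) :
    A2Equiv f g2 ∧
    ¬ ∃ (v₀ : Fin 3 → ℝ) (W : Submodule ℝ (Fin 3 → ℝ)),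
        Module.finrank ℝ W = 2 ∧
        ∀ v ∈ {v : Fin 3 → ℝ | ∃ a b c : ℝ, a ^ 2 + b ^ 2 = 1 ∧
          v = ![2 * a ^ 2 + 2 * c ^ 2, 2 * a * b + 2 * a * c, 2 * b ^ 2]},
          v - v₀ ∈ W := by
  constructor
  · have hcomp : targetShear ∘ f ∘ id = g2 := by
      funext p
      ext i
      fin_cases i <;> simp [targetShear, g2, hf]
    refine ⟨id, targetShear, .refl ℝ _, .refl ℝ _, contDiff_id, contDiff_targetShear, rfl, ?_,
      hasFDerivAt_id 0, hasFDerivAt_targetShear_zero, fun k _ => by rw [hcomp]⟩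
    ext i
    fin_cases i <;> simp [targetShear]
  · rintro ⟨v₀, W, hW, h⟩
    have key (a b c : ℝ) (hab : a ^ 2 + b ^ 2 = 1) :
        ![2 * a ^ 2 + 2 * c ^ 2, 2 * a * b + 2 * a * c, 2 * b ^ 2] - v₀ ∈ W :=
      h _ ⟨a, b, c, hab, rfl⟩
    have h₀ := key 1 0 0 (by norm_num)
    have h₁ := W.sub_mem (key 1 0 1 (by norm_num)) h₀
    have h₂ := W.sub_mem (key 1 0 (-1) (by norm_num)) h₀
    have h₃ := W.sub_mem (key 0 1 0 (by norm_num)) h₀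
    have htop : W = ⊤ := by
      refine eq_top_iff.2 fun v _ => ?_
      convert W.add_mem (W.add_mem (W.smul_mem ((v 0 + v 2 + v 1) / 4) h₁)
        (W.smul_mem ((v 0 + v 2 - v 1) / 4) h₂)) (W.smul_mem (v 2 / 2) h₃) using 1
      ext i
      fin_cases i <;> simp <;> ring
    rw [htop, finrank_top, Module.finrank_fin_fun] at hW
    omega
end
end

section
/- Let f(x,y,z) = (x, y, xz + y², yz, z²). Then (a) f is A²-equivalent to g₁(x,y,z) = (x,y,xz,yz,z²), and (b) the curvature locus Δ_f = {(2b² + 2ac, 2bc, 2c²) ∈ ℝ³ : a, b, c ∈ ℝ, a² + b² = 1} is not a paraboloid: there is no affine isometry e of ℝ³ such that the image of {(u,v,w) ∈ ℝ³ : u² + v² = 2w} under e equals Δ_f. -/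
noncomputable section

/-- The curvature locus of `f(x,y,z) = (x, y, xz + y², yz, z²)`, as a subset of
the Euclidean normal space `ℝ³`. -/
def Δf : Set (EuclideanSpace ℝ (Fin 3)) :=
  {v | ∃ a b c : ℝ, a ^ 2 + b ^ 2 = 1 ∧
    v = (WithLp.equiv 2 (Fin 3 → ℝ)).symm
      ![2 * b ^ 2 + 2 * a * c, 2 * b * c, 2 * c ^ 2]}

/-- The paraboloid `u² + v² = 2w`, the curvature locus of the cross-cap. -/
def paraboloid : Set (EuclideanSpace ℝ (Fin 3)) :=
  {v | v 0 ^ 2 + v 1 ^ 2 = 2 * v 2}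

/-- A paraboloid of revolution contains no nontrivial segment: it cannot contain two
distinct points together with their midpoint. -/
theorem eq_of_midpoint_mem_paraboloid {p q : EuclideanSpace ℝ (Fin 3)}
    (hp : p ∈ paraboloid) (hq : q ∈ paraboloid) (hm : midpoint ℝ p q ∈ paraboloid) :
    p = q := by
  simp only [paraboloid, Set.mem_ofPred_eq, midpoint_eq_smul_add, PiLp.smul_apply,
    PiLp.add_apply, smul_eq_mul, invOf_eq_inv] at hp hq hm
  have h : (p 0 - q 0) ^ 2 + (p 1 - q 1) ^ 2 = 0 := by linarith
  have h0 : p 0 = q 0 := by nlinarith [sq_nonneg (p 0 - q 0), sq_nonneg (p 1 - q 1)]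
  have h1 : p 1 = q 1 := by nlinarith [sq_nonneg (p 0 - q 0), sq_nonneg (p 1 - q 1)]
  have h2 : p 2 = q 2 := by rw [h0, h1] at hp; linarith
  ext i
  fin_cases i <;> assumption

/-- The curvature locus `Δf` contains the segment from `(0,0,0)` to `(2,0,0)`. -/
theorem mem_Δf_of_mem_Icc {t : ℝ} (ht : t ∈ Set.Icc (0 : ℝ) 2) : !₂[t, 0, 0] ∈ Δf := by
  refine ⟨√(1 - t / 2), √(t / 2), 0, ?_, ?_⟩
  · rw [Real.sq_sqrt (by linarith [ht.2]), Real.sq_sqrt (by linarith [ht.1])]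
    ring
  · rw [Real.sq_sqrt (by linarith [ht.1])]
    ext i
    fin_cases i <;> simp
    ring

/-- The polynomial diffeomorphism of the target removing the term `y²`. -/
def shear (u : Fin 5 → ℝ) : Fin 5 → ℝ := ![u 0, u 1, u 2 - u 1 ^ 2, u 3, u 4]

theorem contDiff_shear : ContDiff ℝ (⊤ : ℕ∞) shear := by
  rw [contDiff_pi]
  intro i
  fin_cases i <;> simp [shear] <;> fun_prop

theorem hasFDerivAt_shear_zero :
    HasFDerivAt shear (ContinuousLinearEquiv.refl ℝ (Fin 5 → ℝ) :
      (Fin 5 → ℝ) →L[ℝ] (Fin 5 → ℝ)) 0 := by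
  have hproj (i : Fin 5) : HasFDerivAt (fun u : Fin 5 → ℝ => u i)
      (ContinuousLinearMap.proj (R := ℝ) (φ := fun _ : Fin 5 => ℝ) i) 0 :=
    hasFDerivAt_apply i 0
  rw [hasFDerivAt_pi']
  intro i
  fin_cases i
  · exact hproj 0
  · exact hproj 1
  · refine ((hproj 2).sub ((hproj 1).pow 2)).congr_fderiv ?_
    ext u
    simp
  · exact hproj 3
  · exact hproj 4

/-- The map `f(x,y,z) = (x, y, xz + y², yz, z²)` is `𝒜²`-equivalent to the
cross-cap `(x,y,xz,yz,z²)`, yet its curvature locus is not a paraboloid: no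
affine isometry of `ℝ³` carries the paraboloid `u² + v² = 2w` onto it. -/
theorem A2_type_does_not_determine_locus
    (f : (Fin 3 → ℝ) → (Fin 5 → ℝ))
    (hf : ∀ p, f p = ![p 0, p 1, p 0 * p 2 + p 1 ^ 2, p 1 * p 2, p 2 ^ 2]) :
    A2Equiv f g1 ∧
    ¬ ∃ e : EuclideanSpace ℝ (Fin 3) ≃ᵢ EuclideanSpace ℝ (Fin 3),
        e '' paraboloid = Δf := by
  constructor
  · refine ⟨id, shear, .refl ℝ _, .refl ℝ _, contDiff_id, contDiff_shear, rfl, ?_,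
      hasFDerivAt_id 0, hasFDerivAt_shear_zero, fun k _ => ?_⟩
    · ext i
      fin_cases i <;> simp [shear]
    · have h : shear ∘ f ∘ id = g1 := by
        funext p
        simp [shear, hf, g1]
      rw [h]
  · rintro ⟨e, he⟩
    obtain ⟨p, hp, hep⟩ := he ▸ mem_Δf_of_mem_Icc (t := 0) (by norm_num)
    obtain ⟨q, hq, heq⟩ := he ▸ mem_Δf_of_mem_Icc (t := 2) (by norm_num)
    obtain ⟨m, hm, hem⟩ := he ▸ mem_Δf_of_mem_Icc (t := 1) (by norm_num)
    have hmid : m = midpoint ℝ p q := by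
      apply e.injective
      rw [e.map_midpoint, hem, hep, heq]
      ext i
      fin_cases i <;> simp [midpoint_eq_smul_add]
    have hpq := eq_of_midpoint_mem_paraboloid hp hq (hmid ▸ hm)
    rw [hpq, heq] at hep
    simpa using congrArg (fun v : EuclideanSpace ℝ (Fin 3) => v 0) hep
end
end

section
/- The curvature locus at the origin of the regular 3-manifold in ℝ⁶ parametrised by f̄(x,y,z) = (x, y, z, xz, yz, z²) is an ellipsoid (in fact a sphere): the set {(2ac, 2bc, 2c²) ∈ ℝ³ : a, b, c ∈ ℝ, a² + b² + c² = 1} equals the set {(u,v,w) ∈ ℝ³ : u² + v² + (w − 1)² = 1}. -/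
/-- The curvature locus at the origin of the regular 3-manifold in `ℝ⁶`
parametrised by `(x,y,z,xz,yz,z²)` (the lift of the 3-dimensional cross-cap)
is the sphere `u² + v² + (w − 1)² = 1`. -/
theorem lifted_crosscap_curvature_locus_is_ellipsoid :
    {p : ℝ × ℝ × ℝ | ∃ a b c : ℝ, a ^ 2 + b ^ 2 + c ^ 2 = 1 ∧
        p = (2 * a * c, 2 * b * c, 2 * c ^ 2)} =
      {p : ℝ × ℝ × ℝ | p.1 ^ 2 + p.2.1 ^ 2 + (p.2.2 - 1) ^ 2 = 1} := by
  ext ⟨u, v, w⟩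
  simp only [Set.mem_ofPred_eq, Prod.mk.injEq]
  constructor
  · rintro ⟨a, b, c, h, rfl, rfl, rfl⟩
    linear_combination 4 * c ^ 2 * h
  · intro h
    have hw : 0 ≤ w := by nlinarith [sq_nonneg u, sq_nonneg v, sq_nonneg w]
    rcases hw.eq_or_lt with rfl | hpos
    · have hu : u = 0 := by nlinarith [sq_nonneg u, sq_nonneg v]
      have hv : v = 0 := by nlinarith [sq_nonneg u, sq_nonneg v]
      exact ⟨1, 0, 0, by norm_num, by simp [hu], by simp [hv], by norm_num⟩
    · obtain ⟨c, hc, hcw⟩ : ∃ c : ℝ, 0 < c ∧ w = 2 * c ^ 2 :=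
        ⟨√(w / 2), by positivity, by rw [Real.sq_sqrt (by positivity)]; ring⟩
      subst hcw
      refine ⟨u / (2 * c), v / (2 * c), c, ?_, by field_simp, by field_simp, rfl⟩
      field_simp
      linear_combination h
end
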